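/- Assume hypotheses (H), let λ_0 be a principal eigenvalue for the weight f_0, and let λ_∞ be a principal eigenvalue for the weight f_∞ if f_∞>0 on [0,1], while λ_∞:=+∞ if f_∞≡0 (and N=1). Then there exists a map u:(λ_0,λ_∞)→C([0,1],ℝ) which is continuously Fréchet differentiable (as a map from the open interval into the Banach space C([0,1],ℝ) with sup norm) such that for every λ∈(λ_0,λ_∞): u(λ)∈C^1([0,1],ℝ), φ_p∘u(λ)'∈C^1([0,1],ℝ), u(λ)(r)>0 for all r∈[0,1), and (λ,u(λ)) is a nontrivial solution of (P). Moreover, the set of all nontrivial solutions (λ,v) of (P) with λ>0 is exactly {(λ,u(λ)) : λ∈(λ_0,λ_∞)}, and |u(λ)|_0→0 as λ→λ_0⁺ while |u(λ)|_0→∞ as λ→λ_∞⁻. -/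

import Mathlib

open Set MeasureTheory Filter Topology intervalIntegral

noncomputable section

/-- `phi p ξ = |ξ|^(p-2) ξ`, the function `φ_p`. -/
def phi (p ξ : ℝ) : ℝ := |ξ| ^ (p - 2) * ξ

/-- The (one-sided at endpoints) derivative of a function on `[0,1]`. -/
def deriv01 (u : ℝ → ℝ) (r : ℝ) : ℝ := derivWithin u (Set.Icc 0 1) r

/-- `u ∈ C^1([0,1],ℝ)`. -/
def C1on01 (u : ℝ → ℝ) : Prop :=
  (∀ r ∈ Set.Icc (0:ℝ) 1, DifferentiableWithinAt ℝ u (Set.Icc 0 1) r) ∧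
  ContinuousOn (deriv01 u) (Set.Icc 0 1)

/-- `J(h)(s) = ∫_0^s (t/s)^(N-1) h(t) dt`, with `J(h)(0) = 0`. -/
def Jmap (N : ℕ) (h : ℝ → ℝ) (s : ℝ) : ℝ :=
  if s = 0 then 0 else ∫ t in (0:ℝ)..s, (t / s) ^ (N - 1) * h t

/-- `S_p(h)(r) = ∫_r^1 φ_{p'}(J(h)(s)) ds` where `p' = p/(p-1)`. -/
def Sp (p : ℝ) (N : ℕ) (h : ℝ → ℝ) (r : ℝ) : ℝ :=
  ∫ s in r..(1:ℝ), phi (p / (p - 1)) (Jmap N h s)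

/-- The sup norm over `[0,1]`. -/
def norm0 (h : ℝ → ℝ) : ℝ := sSup ((fun t => |h t|) '' Set.Icc 0 1)

/-- `u` is not identically zero on `[0,1]`. -/
def Nontriv01 (u : ℝ → ℝ) : Prop := ∃ r ∈ Set.Icc (0:ℝ) 1, u r ≠ 0

/-- `(lam, u)` is a solution of problem (P):
`-(r^(N-1) φ_p(u'))' = lam r^(N-1) f(r, u(r))` on `(0,1)`, `u'(0) = u(1) = 0`. -/
def IsSolutionP (p : ℝ) (N : ℕ) (f : ℝ → ℝ → ℝ) (lam : ℝ) (u : ℝ → ℝ) : Prop :=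
  C1on01 u ∧ C1on01 (fun r => phi p (deriv01 u r)) ∧
  (∀ r ∈ Set.Ioo (0:ℝ) 1,
      HasDerivAt (fun s => s ^ (N - 1) * phi p (deriv01 u s))
        (-(lam * r ^ (N - 1) * f r (u r))) r) ∧
  deriv01 u 0 = 0 ∧ u 1 = 0

/-- `(lam, v)` is a principal eigenpair for the weight `w`. -/
def IsPrincipalEigenpair (p : ℝ) (N : ℕ) (w : ℝ → ℝ) (lam : ℝ) (v : ℝ → ℝ) : Prop :=
  0 < lam ∧ C1on01 v ∧ C1on01 (fun r => phi p (deriv01 v r)) ∧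
  (∀ r ∈ Set.Ico (0:ℝ) 1, 0 < v r) ∧
  (∀ r ∈ Set.Ioo (0:ℝ) 1,
      HasDerivAt (fun s => s ^ (N - 1) * phi p (deriv01 v s))
        (-(lam * r ^ (N - 1) * w r * phi p (v r))) r) ∧
  deriv01 v 0 = 0 ∧ v 1 = 0

/-- Extension of a continuous function on `[0,1]` to `ℝ` (constant outside `[0,1]`). -/
def extCI (g : C(Set.Icc (0:ℝ) 1, ℝ)) : ℝ → ℝ := Set.IccExtend zero_le_one ⇑g

/-- Hypotheses (H) of the paper: (H1)–(H6), with `f₂ = ∂₂f` and asymptotes `f0`, `finf`. -/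
structure HypH (p : ℝ) (N : ℕ) (f f₂ : ℝ → ℝ → ℝ) (f0 finf : ℝ → ℝ) : Prop where
  hp : 2 < p
  hN : 1 ≤ N
  hf_cont : ContinuousOn (fun q : ℝ × ℝ => f q.1 q.2) (Set.Icc 0 1 ×ˢ Set.univ)
  hf_deriv : ∀ r ∈ Set.Icc (0:ℝ) 1, ∀ ξ : ℝ, HasDerivAt (fun t => f r t) (f₂ r ξ) ξ
  hf₂_cont : ContinuousOn (fun q : ℝ × ℝ => f₂ q.1 q.2) (Set.Icc 0 1 ×ˢ Set.univ)
  hH2 : ∀ r ∈ Set.Icc (0:ℝ) 1, ∀ ξ : ℝ, ξ ≠ 0 → 0 < f r ξ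
  hf_zero : ∀ r ∈ Set.Icc (0:ℝ) 1, f r 0 = 0
  hH3 : ∀ r ∈ Set.Icc (0:ℝ) 1, ∀ ξ : ℝ, 0 ≤ ξ → f₂ r ξ * ξ ≤ (p - 1) * f r ξ
  hH3s : ∃ δ > 0, ∃ ε > 0, ∀ r ∈ Set.Ioc (1 - δ) 1, ∀ ξ ∈ Set.Ioo (0:ℝ) ε,
      f₂ r ξ * ξ < (p - 1) * f r ξ
  hf0_cont : ContinuousOn f0 (Set.Icc 0 1)
  hfinf_cont : ContinuousOn finf (Set.Icc 0 1)
  hH4a : ∀ e > 0, ∃ d > 0, ∀ ξ ∈ Set.Ioo (0:ℝ) d, ∀ r ∈ Set.Icc (0:ℝ) 1,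
      |f r ξ / phi p ξ - f0 r| < e
  hH4b : ∀ e > 0, ∃ d > 0, ∀ ξ ∈ Set.Ioo (0:ℝ) d, ∀ r ∈ Set.Icc (0:ℝ) 1,
      |f₂ r ξ / ξ ^ (p - 2) - (p - 1) * f0 r| < e
  hH5 : ∀ e > 0, ∃ M : ℝ, ∀ ξ : ℝ, M ≤ ξ → ∀ r ∈ Set.Icc (0:ℝ) 1,
      |f r ξ / phi p ξ - finf r| < e
  hH6 : (∀ r ∈ Set.Icc (0:ℝ) 1, 0 < finf r) ∨ (N = 1 ∧ ∀ r ∈ Set.Icc (0:ℝ) 1, finf r = 0)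

/-- A continuously differentiable global curve `λ ↦ u(λ)` of positive solutions of (P),
parametrized by `λ ∈ Λ`, exhausting all nontrivial solutions, with `|u(λ)|₀ → 0` as
`λ → λ₀⁺` and `|u(λ)|₀ → ∞` along the filter `linf`. -/
def SolCurve (p : ℝ) (N : ℕ) (f : ℝ → ℝ → ℝ) (lam0 : ℝ) (Λ : Set ℝ)
    (linf : Filter ℝ) : Prop :=
  ∃ U U' : ℝ → C(Set.Icc (0:ℝ) 1, ℝ),
    -- continuously Fréchet differentiable on Λ
    (∀ lam ∈ Λ, HasDerivAt U (U' lam) lam) ∧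
    ContinuousOn U' Λ ∧
    -- each u(λ) is a positive nontrivial solution
    (∀ lam ∈ Λ,
      IsSolutionP p N f lam (extCI (U lam)) ∧ Nontriv01 (extCI (U lam)) ∧
      ∀ r ∈ Set.Ico (0:ℝ) 1, 0 < extCI (U lam) r) ∧
    -- every nontrivial solution with λ > 0 lies on the curve
    (∀ (lam : ℝ) (v : ℝ → ℝ), 0 < lam → IsSolutionP p N f lam v → Nontriv01 v →
      lam ∈ Λ ∧ Set.EqOn v (extCI (U lam)) (Set.Icc 0 1)) ∧
    -- asymptotic behaviour of |u(λ)|₀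
    Filter.Tendsto (fun lam => ‖U lam‖) (nhdsWithin lam0 (Set.Ioi lam0)) (nhds 0) ∧
    Filter.Tendsto (fun lam => ‖U lam‖) linf Filter.atTop

/-! ### Continuous functions on the unit interval -/

/-- The Banach space of continuous functions on `[0,1]`. -/
abbrev CI := C(Set.Icc (0:ℝ) 1, ℝ)

lemma continuous_extCI (g : CI) : Continuous (extCI g) := g.continuous.Icc_extend'

lemma extCI_of_mem (g : CI) {r : ℝ} (hr : r ∈ Set.Icc (0:ℝ) 1) : extCI g r = g ⟨r, hr⟩ :=
  Set.IccExtend_of_mem _ _ hr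

lemma extCI_coe (g : CI) (r : Set.Icc (0:ℝ) 1) : extCI g r = g r := extCI_of_mem g r.2

lemma abs_extCI_le (g : CI) (r : ℝ) : |extCI g r| ≤ ‖g‖ := by
  simpa [extCI, Set.IccExtend] using g.norm_coe_le_norm (Set.projIcc 0 1 zero_le_one r)

lemma extCI_add (g h : CI) (r : ℝ) : extCI (g + h) r = extCI g r + extCI h r := rfl

lemma extCI_smul (c : ℝ) (g : CI) (r : ℝ) : extCI (c • g) r = c * extCI g r := rfl

lemma extCI_exists (g : CI) (r : ℝ) : ∃ s : Set.Icc (0:ℝ) 1, extCI g r = g s :=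
  ⟨Set.projIcc 0 1 zero_le_one r, rfl⟩

/-- The weighted average `h ↦ (s ↦ ∫₀¹ t^(N-1) h(st) dt)`. -/
def wavg (N : ℕ) : CI →L[ℝ] CI :=
  LinearMap.mkContinuous
    { toFun := fun h => ⟨fun s => ∫ t in (0:ℝ)..1, t ^ (N - 1) * extCI h (s * t), by
        have := continuous_extCI h
        exact intervalIntegral.continuous_parametric_intervalIntegral_of_continuous'
          (by fun_prop) 0 1⟩
      map_add' := fun g h => by
        ext s
        have h1 := continuous_extCI g
        have h2 := continuous_extCI h
        simp only [ContinuousMap.coe_mk, ContinuousMap.add_apply, extCI_add, mul_add]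
        exact intervalIntegral.integral_add
          (Continuous.intervalIntegrable (by fun_prop) _ _)
          (Continuous.intervalIntegrable (by fun_prop) _ _)
      map_smul' := fun c h => by
        ext s
        simp only [ContinuousMap.coe_mk, ContinuousMap.smul_apply, extCI_smul, smul_eq_mul,
          RingHom.id_apply, mul_left_comm _ c]
        exact intervalIntegral.integral_const_mul _ _ } 1 (fun h => by
    rw [ContinuousMap.norm_le _ (by positivity)]
    intro s
    have := intervalIntegral.norm_integral_le_of_norm_le_const (a := 0) (b := 1)
      (f := fun t : ℝ => t ^ (N - 1) * extCI h (s * t)) (C := ‖h‖) (by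
        intro t ht
        rw [Set.uIoc_of_le zero_le_one] at ht
        rw [norm_mul, norm_pow, Real.norm_of_nonneg ht.1.le]
        calc t ^ (N - 1) * ‖extCI h (s * t)‖ ≤ 1 * ‖h‖ := by
              gcongr
              · exact pow_le_one₀ ht.1.le ht.2
              · exact abs_extCI_le _ _
          _ = ‖h‖ := one_mul _)
    simpa using this)

lemma wavg_apply (N : ℕ) (h : CI) (s : Set.Icc (0:ℝ) 1) :
    wavg N h s = ∫ t in (0:ℝ)..1, t ^ (N - 1) * extCI h (s * t) := rfl

lemma pow_mul_wavg {N : ℕ} (hN : 1 ≤ N) (h : CI) {s : ℝ} (hs : s ∈ Set.Icc (0:ℝ) 1) :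
    s ^ N * extCI (wavg N h) s = ∫ t in (0:ℝ)..s, t ^ (N - 1) * extCI h t := by
  have h1 := intervalIntegral.mul_integral_comp_mul_left (a := 0) (b := 1) s
    (f := fun x => x ^ (N - 1) * extCI h x)
  rw [mul_zero, mul_one] at h1
  rw [← h1, extCI_of_mem _ hs, wavg_apply]
  obtain ⟨n, rfl⟩ : ∃ n, N = n + 1 := ⟨N - 1, by omega⟩
  rw [← intervalIntegral.integral_const_mul, ← intervalIntegral.integral_const_mul]
  congr 1
  ext t
  simp only [Nat.add_sub_cancel, mul_pow]
  ring

lemma wavg_nonneg (N : ℕ) {h : CI} (hh : ∀ r, 0 ≤ h r) (s : Set.Icc (0:ℝ) 1) :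
    0 ≤ wavg N h s := by
  rw [wavg_apply]
  refine intervalIntegral.integral_nonneg zero_le_one fun t ht => ?_
  obtain ⟨x, hx⟩ := extCI_exists h (s * t)
  rw [hx]
  exact mul_nonneg (pow_nonneg ht.1 _) (hh x)

lemma wavg_pos (N : ℕ) {h : CI} (hh : ∀ r, 0 ≤ h r) (h0 : 0 < extCI h 0)
    (s : Set.Icc (0:ℝ) 1) : 0 < wavg N h s := by
  rw [wavg_apply]
  have hc := continuous_extCI h
  have hev : ∀ᶠ t in 𝓝 (0:ℝ), 0 < extCI h (s * t) := by
    have : Continuous fun t : ℝ => extCI h (s * t) := by fun_prop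
    refine this.continuousAt.eventually (lt_mem_nhds ?_)
    simpa using h0
  obtain ⟨c, hc1, hc0, hc2⟩ : ∃ c : ℝ, 0 < extCI h (s * c) ∧ 0 < c ∧ c < 1 := by
    obtain ⟨c, hc⟩ := ((hev.filter_mono nhdsWithin_le_nhds).and
      (Ioo_mem_nhdsGT (zero_lt_one (α := ℝ)))).exists
    exact ⟨c, hc.1, hc.2.1, hc.2.2⟩
  refine intervalIntegral.integral_pos zero_lt_one (by fun_prop) (fun t ht => ?_)
    ⟨c, ⟨hc0.le, hc2.le⟩, by positivity⟩
  obtain ⟨x, hx⟩ := extCI_exists h (s * t)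
  rw [hx]
  exact mul_nonneg (pow_nonneg ht.1.le _) (hh x)

lemma hasDerivAt_pow_mul_wavg {N : ℕ} (hN : 1 ≤ N) (h : CI) {r : ℝ}
    (hr : r ∈ Set.Ioo (0:ℝ) 1) :
    HasDerivAt (fun s => s ^ N * extCI (wavg N h) s) (r ^ (N - 1) * extCI h r) r := by
  have hc := continuous_extCI h
  have hc' : Continuous fun t : ℝ => t ^ (N - 1) * extCI h t := by fun_prop
  refine (hc'.integral_hasStrictDerivAt (0:ℝ) r).hasDerivAt.congr_of_eventuallyEq ?_
  filter_upwards [Icc_mem_nhds hr.1 hr.2] with s hs using pow_mul_wavg hN h hs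

lemma continuous_rpow_mul_extCI {β : ℝ} (hβ : 0 ≤ β) (g : CI) :
    Continuous fun s : ℝ => s ^ β * extCI g s :=
  (Real.continuous_rpow_const hβ).mul (continuous_extCI g)

lemma abs_integral_rpow_mul_le {β : ℝ} (hβ : 0 ≤ β) (g : CI) {a b : ℝ}
    (ha : a ∈ Set.Icc (0:ℝ) 1) (hb : b ∈ Set.Icc (0:ℝ) 1) :
    |∫ s in a..b, s ^ β * extCI g s| ≤ ‖g‖ * |b - a| := by
  rw [← Real.norm_eq_abs]
  refine intervalIntegral.norm_integral_le_of_norm_le_const fun s hs => ?_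
  have hs' : s ∈ Set.Icc (0:ℝ) 1 :=
    Set.uIcc_subset_Icc ha hb (Set.uIoc_subset_uIcc hs)
  rw [norm_mul, Real.norm_of_nonneg (Real.rpow_nonneg hs'.1 _)]
  calc s ^ β * ‖extCI g s‖ ≤ 1 * ‖g‖ := by
        gcongr
        · exact Real.rpow_le_one hs'.1 hs'.2 hβ
        · exact abs_extCI_le _ _
    _ = ‖g‖ := one_mul _

/-- The operator `g ↦ (r ↦ ∫ᵣ¹ s^β g(s) ds)`, for `β ≥ 0` (zero for negative `β`). -/
def ctail (β : ℝ) : CI →L[ℝ] CI :=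
  if hβ : 0 ≤ β then
    LinearMap.mkContinuous
      { toFun := fun g => ⟨fun r => ∫ s in (r:ℝ)..1, s ^ β * extCI g s, by
          have h1 : Continuous fun r : ℝ => ∫ s in r..1, s ^ β * extCI g s := by
            simp_rw [fun r : ℝ => intervalIntegral.integral_symm (μ := volume)
              (f := fun s => s ^ β * extCI g s) (1:ℝ) r]
            exact (intervalIntegral.continuous_primitive
              (fun a b => (continuous_rpow_mul_extCI hβ g).intervalIntegrable a b) 1).neg
          exact h1.comp continuous_subtype_val⟩
        map_add' := fun g h => by
          ext s
          simp only [ContinuousMap.coe_mk, ContinuousMap.add_apply, extCI_add, mul_add]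
          exact intervalIntegral.integral_add
            ((continuous_rpow_mul_extCI hβ g).intervalIntegrable _ _)
            ((continuous_rpow_mul_extCI hβ h).intervalIntegrable _ _)
        map_smul' := fun c h => by
          ext s
          simp only [ContinuousMap.coe_mk, ContinuousMap.smul_apply, extCI_smul, smul_eq_mul,
            RingHom.id_apply, mul_left_comm _ c]
          exact intervalIntegral.integral_const_mul _ _ } 1 (fun g => by
      rw [ContinuousMap.norm_le _ (by positivity)]
      intro r
      refine (abs_integral_rpow_mul_le hβ g r.2 ⟨zero_le_one, le_rfl⟩).trans ?_
      rw [one_mul]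
      refine mul_le_of_le_one_right (norm_nonneg _) ?_
      rw [abs_of_nonneg] <;> linarith [r.2.1, r.2.2])
  else 0

lemma ctail_apply {β : ℝ} (hβ : 0 ≤ β) (g : CI) (r : Set.Icc (0:ℝ) 1) :
    ctail β g r = ∫ s in (r:ℝ)..1, s ^ β * extCI g s := by
  rw [ctail, dif_pos hβ]; rfl

lemma extCI_ctail {β : ℝ} (hβ : 0 ≤ β) (g : CI) {r : ℝ} (hr : r ∈ Set.Icc (0:ℝ) 1) :
    extCI (ctail β g) r = ∫ s in r..1, s ^ β * extCI g s := by
  rw [extCI_of_mem _ hr, ctail_apply hβ]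

lemma extCI_ctail_one {β : ℝ} (hβ : 0 ≤ β) (g : CI) : extCI (ctail β g) 1 = 0 := by
  rw [extCI_ctail hβ g ⟨zero_le_one, le_rfl⟩, intervalIntegral.integral_same]

lemma hasDerivWithinAt_ctail {β : ℝ} (hβ : 0 ≤ β) (g : CI) {r : ℝ}
    (hr : r ∈ Set.Icc (0:ℝ) 1) :
    HasDerivWithinAt (extCI (ctail β g)) (-(r ^ β * extCI g r)) (Set.Icc 0 1) r := by
  have hc := continuous_rpow_mul_extCI hβ g
  have h1 := ((hc.integral_hasStrictDerivAt 1 r).hasDerivAt.neg).hasDerivWithinAt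
    (s := Set.Icc (0:ℝ) 1)
  refine h1.congr (fun s hs => ?_) ?_
  · rw [extCI_ctail hβ g hs, intervalIntegral.integral_symm]; rfl
  · rw [extCI_ctail hβ g hr, intervalIntegral.integral_symm]; rfl

lemma hasDerivAt_ctail {β : ℝ} (hβ : 0 ≤ β) (g : CI) {r : ℝ} (hr : r ∈ Set.Ioo (0:ℝ) 1) :
    HasDerivAt (extCI (ctail β g)) (-(r ^ β * extCI g r)) r :=
  (hasDerivWithinAt_ctail hβ g (Set.Ioo_subset_Icc_self hr)).hasDerivAt
    (Icc_mem_nhds hr.1 hr.2)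

lemma ctail_mono {β : ℝ} (hβ : 0 ≤ β) {g h : CI} (hgh : ∀ r, g r ≤ h r)
    (r : Set.Icc (0:ℝ) 1) : ctail β g r ≤ ctail β h r := by
  rw [ctail_apply hβ, ctail_apply hβ]
  refine intervalIntegral.integral_mono_on r.2.2
    ((continuous_rpow_mul_extCI hβ g).intervalIntegrable _ _)
    ((continuous_rpow_mul_extCI hβ h).intervalIntegrable _ _) fun s hs => ?_
  have h0 : 0 ≤ s := r.2.1.trans hs.1
  exact mul_le_mul_of_nonneg_left (hgh (Set.projIcc 0 1 zero_le_one s)) (Real.rpow_nonneg h0 _)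

lemma ctail_nonneg {β : ℝ} (hβ : 0 ≤ β) {g : CI} (hg : ∀ r, 0 ≤ g r)
    (r : Set.Icc (0:ℝ) 1) : 0 ≤ ctail β g r := by
  have h := ctail_mono hβ (g := 0) (h := g) (fun r => by simpa using hg r) r
  rwa [map_zero] at h

lemma ctail_pos {β : ℝ} (hβ : 0 ≤ β) {g : CI} (hg : ∀ r, 0 < g r)
    {r : ℝ} (hr : r ∈ Set.Ico (0:ℝ) 1) : 0 < extCI (ctail β g) r := by
  rw [extCI_ctail hβ g ⟨hr.1, hr.2.le⟩]
  have hp : ∀ s : ℝ, 0 < s → 0 < s ^ β * extCI g s := fun s hs =>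
    mul_pos (Real.rpow_pos_of_pos hs _) (hg _)
  exact intervalIntegral.integral_pos hr.2 (continuous_rpow_mul_extCI hβ g).continuousOn
    (fun s hs => (hp s (hr.1.trans_lt hs.1)).le)
    ⟨1, ⟨hr.2.le, le_rfl⟩, hp 1 one_pos⟩

lemma ctail_le_zero {β : ℝ} (hβ : 0 ≤ β) {g : CI} (hg : ∀ r, 0 ≤ g r)
    (r : Set.Icc (0:ℝ) 1) : ctail β g r ≤ extCI (ctail β g) 0 := by
  have h0 : (0:ℝ) ∈ Set.Icc (0:ℝ) 1 := ⟨le_rfl, zero_le_one⟩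
  have hc := continuous_rpow_mul_extCI hβ g
  rw [extCI_ctail hβ g h0, ctail_apply hβ,
    ← intervalIntegral.integral_add_adjacent_intervals (hc.intervalIntegrable 0 r)
      (hc.intervalIntegrable r 1)]
  refine le_add_of_nonneg_left (intervalIntegral.integral_nonneg r.2.1 fun s hs => ?_)
  exact mul_nonneg (Real.rpow_nonneg hs.1 _) (hg _)

/-- The functions bounded by `1` and `1`-Lipschitz on `[0,1]`. -/
lemma isCompact_lipschitz_unit : IsCompact
    {u : CI | (∀ x, u x ∈ Set.Icc (-1:ℝ) 1) ∧ ∀ x y, |u x - u y| ≤ |(y:ℝ) - x|} := by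
  refine ArzelaAscoli.isCompact_of_equicontinuous _ ?_ ?_
  · have himg : (ContinuousMap.toFun '' {u : CI | (∀ x, u x ∈ Set.Icc (-1:ℝ) 1) ∧
        ∀ x y, |u x - u y| ≤ |(y:ℝ) - x|}) =
        (Set.univ.pi fun _ : Set.Icc (0:ℝ) 1 => Set.Icc (-1:ℝ) 1) ∩
          {u | ∀ x y, |u x - u y| ≤ |(y:ℝ) - x|} := by
      ext u
      constructor
      · rintro ⟨v, ⟨h1, h2⟩, rfl⟩
        exact ⟨fun x _ => h1 x, h2⟩
      · rintro ⟨h1, h2⟩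
        have hl : LipschitzWith 1 u := LipschitzWith.of_dist_le_mul fun x y => by
          rw [Real.dist_eq, NNReal.coe_one, one_mul, Subtype.dist_eq, Real.dist_eq, abs_sub_comm (x:ℝ)]
          exact h2 x y
        exact ⟨⟨u, hl.continuous⟩, ⟨fun x => h1 x trivial, h2⟩, rfl⟩
    rw [himg]
    refine (isCompact_univ_pi fun _ => isCompact_Icc).inter_right ?_
    simp only [Set.ofPred_forall]
    refine isClosed_iInter fun x => isClosed_iInter fun y => isClosed_le ?_ continuous_const
    exact ((continuous_apply x).sub (continuous_apply y)).abs
  · refine Metric.equicontinuous_of_continuity_modulus id tendsto_id _ fun x y u => ?_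
    have := u.2.2 x y
    rwa [id, Subtype.dist_eq, Real.dist_eq, Real.dist_eq, abs_sub_comm (x:ℝ)]

lemma isCompactOperator_ctail {β : ℝ} (hβ : 0 ≤ β) : IsCompactOperator (ctail β) := by
  rw [isCompactOperator_iff_exists_mem_nhds_image_subset_compact]
  refine ⟨Metric.closedBall 0 1, Metric.closedBall_mem_nhds _ one_pos, _,
    isCompact_lipschitz_unit, ?_⟩
  rintro _ ⟨g, hg, rfl⟩
  have hg' : ‖g‖ ≤ 1 := by simpa using hg
  have hc := continuous_rpow_mul_extCI hβ g
  constructor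
  · intro x
    rw [Set.mem_Icc, ← abs_le, ctail_apply hβ]
    refine (abs_integral_rpow_mul_le hβ g x.2 ⟨zero_le_one, le_rfl⟩).trans ?_
    have : |1 - (x:ℝ)| ≤ 1 := by rw [abs_of_nonneg] <;> linarith [x.2.1, x.2.2]
    nlinarith [norm_nonneg g, abs_nonneg (1 - (x:ℝ))]
  · intro x y
    rw [ctail_apply hβ, ctail_apply hβ, ← intervalIntegral.integral_add_adjacent_intervals
      (hc.intervalIntegrable x y) (hc.intervalIntegrable y 1), add_sub_cancel_right]
    refine (abs_integral_rpow_mul_le hβ g x.2 y.2).trans ?_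
    exact mul_le_of_le_one_left (abs_nonneg _) hg'

/-! ### Superposition operators -/

/-- The superposition operator `u ↦ (r ↦ g(r, u(r)))`. -/
def nem (g : C(Set.Icc (0:ℝ) 1 × ℝ, ℝ)) (u : CI) : CI :=
  g.comp ((ContinuousMap.id _).prodMk u)

lemma nem_apply (g : C(Set.Icc (0:ℝ) 1 × ℝ, ℝ)) (u : CI) (r : Set.Icc (0:ℝ) 1) :
    nem g u r = g (r, u r) := rfl

lemma continuous_nem (g : C(Set.Icc (0:ℝ) 1 × ℝ, ℝ)) : Continuous (nem g) := by
  refine ContinuousMap.continuous_of_continuous_uncurry _ ?_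
  change Continuous fun z : CI × Set.Icc (0:ℝ) 1 => g (z.2, z.1 z.2)
  fun_prop

/-- A superposition operator is strictly differentiable at `u` when its generating function is
continuously differentiable in the second variable near the graph of `u`. -/
lemma hasStrictFDerivAt_nem (g : C(Set.Icc (0:ℝ) 1 × ℝ, ℝ)) {g' : Set.Icc (0:ℝ) 1 × ℝ → ℝ}
    {S : Set ℝ} (hS : IsOpen S) (hg' : ContinuousOn g' (Set.univ ×ˢ S))
    (hd : ∀ r, ∀ x ∈ S, HasDerivAt (fun t => g (r, t)) (g' (r, x)) x)
    (u d : CI) (huS : ∀ r, u r ∈ S) (hdu : ∀ r, d r = g' (r, u r)) :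
    HasStrictFDerivAt (nem g) (ContinuousLinearMap.mul ℝ CI d) u := by
  have hloc : ∀ e > 0, ∃ δ > 0, ∀ r x, |x - u r| < δ → x ∈ S ∧ |g' (r, x) - d r| ≤ e := by
    intro e he
    have h1 : ∀ᶠ t in 𝓝 (0:ℝ), ∀ r ∈ (Set.univ : Set (Set.Icc (0:ℝ) 1)),
        u r + t ∈ S ∧ |g' (r, u r + t) - d r| < e := by
      refine isCompact_univ.eventually_forall_of_forall_eventually fun r _ => ?_
      have hc : Tendsto (fun z : ℝ × Set.Icc (0:ℝ) 1 => (z.2, u z.2 + z.1)) (𝓝 (0, r))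
          (𝓝 (r, u r)) := by
        have : Continuous (fun z : ℝ × Set.Icc (0:ℝ) 1 => (z.2, u z.2 + z.1)) := by fun_prop
        have h2 := this.tendsto (0, r)
        simpa using h2
      have hca : ContinuousAt g' (r, u r) :=
        hg'.continuousAt ((isOpen_univ.prod hS).mem_nhds ⟨trivial, huS r⟩)
      have hmem : ∀ᶠ z : ℝ × Set.Icc (0:ℝ) 1 in 𝓝 (0, r), u z.2 + z.1 ∈ S := by
        filter_upwards [hc.eventually ((isOpen_univ.prod hS).mem_nhds ⟨trivial, huS r⟩)] with z hz
        exact hz.2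
      have hdc : Tendsto (fun z : ℝ × Set.Icc (0:ℝ) 1 => |g' (z.2, u z.2 + z.1) - d z.2|)
          (𝓝 (0, r)) (𝓝 0) := by
        have h3 : Tendsto (fun z : ℝ × Set.Icc (0:ℝ) 1 => d z.2) (𝓝 (0, r)) (𝓝 (d r)) :=
          (d.continuous.comp continuous_snd).tendsto (0, r)
        have h4 := ((hca.tendsto.comp hc).sub h3).abs
        rw [hdu r, sub_self, abs_zero] at h4
        exact h4
      exact hmem.and (hdc.eventually (gt_mem_nhds he))
    obtain ⟨δ, hδ, h2⟩ := Metric.eventually_nhds_iff.1 h1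
    refine ⟨δ, hδ, fun r x hx => ?_⟩
    have h3 := h2 (y := x - u r) (by simpa [Real.dist_eq] using hx) r trivial
    rw [add_sub_cancel] at h3
    exact ⟨h3.1, h3.2.le⟩
  rw [hasStrictFDerivAt_iff_isLittleO, Asymptotics.isLittleO_iff]
  intro e he
  obtain ⟨δ, hδ, h⟩ := hloc e he
  filter_upwards [prod_mem_nhds (Metric.ball_mem_nhds u hδ) (Metric.ball_mem_nhds u hδ)]
    with z hz
  obtain ⟨hz1, hz2⟩ := hz
  rw [ContinuousMap.norm_le _ (by positivity)]
  intro r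
  have hb : ∀ v : CI, v ∈ Metric.ball u δ → v r ∈ Metric.ball (u r) δ := fun v hv =>
    (ContinuousMap.dist_apply_le_dist r).trans_lt hv
  have hmv := (convex_ball (u r) δ).norm_image_sub_le_of_norm_hasDerivWithin_le
    (f := fun x => g (r, x) - d r * x) (f' := fun x => g' (r, x) - d r) (C := e)
    (fun x hx => (((hd r x (h r x hx).1).sub
      ((hasDerivAt_id x).const_mul (d r))).congr_deriv (by ring)).hasDerivWithinAt)
    (fun x hx => (h r x hx).2) (hb _ hz2) (hb _ hz1)
  have heq : (nem g z.1 - nem g z.2 - (ContinuousLinearMap.mul ℝ CI d) (z.1 - z.2)) r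
      = (g (r, z.1 r) - d r * z.1 r) - (g (r, z.2 r) - d r * z.2 r) := by
    simp only [ContinuousMap.sub_apply, nem_apply, ContinuousLinearMap.mul_apply',
      ContinuousMap.mul_apply]
    ring
  rw [heq]
  refine hmv.trans ?_
  gcongr
  exact (z.1 - z.2).norm_coe_le_norm r

/-- The power function `(r, x) ↦ x ^ β` for `β ≥ 0` (zero for negative `β`). -/
def powFun (β : ℝ) : C(Set.Icc (0:ℝ) 1 × ℝ, ℝ) :=
  if hβ : 0 ≤ β then ⟨fun z => z.2 ^ β, (Real.continuous_rpow_const hβ).comp continuous_snd⟩ else 0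

lemma powFun_apply {β : ℝ} (hβ : 0 ≤ β) (z : Set.Icc (0:ℝ) 1 × ℝ) : powFun β z = z.2 ^ β := by
  rw [powFun, dif_pos hβ]; rfl

/-- `radSlope p N h (r) = r^(-1/(p-1)) |u'(r)|` where `u` solves
`-(r^(N-1) φ_p(u'))' = r^(N-1) h`. -/
def radSlope (p : ℝ) (N : ℕ) (h : CI) : CI := nem (powFun (p - 1)⁻¹) (wavg N h)

/-- The solution operator of `-(r^(N-1) φ_p(u'))' = r^(N-1) h`, `u'(0) = u(1) = 0`. -/
def solOp (p : ℝ) (N : ℕ) (h : CI) : CI := ctail (p - 1)⁻¹ (radSlope p N h)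

section solOp

variable {p : ℝ} {N : ℕ}

lemma inv_sub_one_nonneg (hp : 2 < p) : 0 ≤ (p - 1)⁻¹ := by
  rw [inv_nonneg]; linarith

lemma radSlope_apply (hp : 2 < p) (h : CI) (r : Set.Icc (0:ℝ) 1) :
    radSlope p N h r = (wavg N h r) ^ (p - 1)⁻¹ := by
  rw [radSlope, nem_apply, powFun_apply (inv_sub_one_nonneg hp)]

lemma radSlope_nonneg (hp : 2 < p) {h : CI} (hh : ∀ r, 0 ≤ h r) (r : Set.Icc (0:ℝ) 1) :
    0 ≤ radSlope p N h r := by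
  rw [radSlope_apply hp]
  exact Real.rpow_nonneg (wavg_nonneg N hh r) _

lemma radSlope_pos (hp : 2 < p) {h : CI} (hh : ∀ r, 0 ≤ h r) (h0 : 0 < extCI h 0)
    (r : Set.Icc (0:ℝ) 1) : 0 < radSlope p N h r := by
  rw [radSlope_apply hp]
  exact Real.rpow_pos_of_pos (wavg_pos N hh h0 r) _

lemma radSlope_rpow (hp : 2 < p) {h : CI} (hh : ∀ r, 0 ≤ h r) (r : Set.Icc (0:ℝ) 1) :
    radSlope p N h r ^ (p - 1) = wavg N h r := by
  rw [radSlope_apply hp, Real.rpow_inv_rpow (wavg_nonneg N hh r) (by linarith)]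

lemma extCI_radSlope_rpow (hp : 2 < p) {h : CI} (hh : ∀ r, 0 ≤ h r) (r : ℝ) :
    extCI (radSlope p N h) r ^ (p - 1) = extCI (wavg N h) r :=
  radSlope_rpow hp hh (Set.projIcc 0 1 zero_le_one r)

lemma continuous_radSlope : Continuous (radSlope p N) :=
  (continuous_nem _).comp (wavg N).continuous

lemma continuous_solOp : Continuous (solOp p N) :=
  (ctail _).continuous.comp continuous_radSlope

lemma solOp_nonneg (hp : 2 < p) {h : CI} (hh : ∀ r, 0 ≤ h r) (r : Set.Icc (0:ℝ) 1) :
    0 ≤ solOp p N h r :=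
  ctail_nonneg (inv_sub_one_nonneg hp) (radSlope_nonneg hp hh) r

lemma solOp_pos (hp : 2 < p) {h : CI} (hh : ∀ r, 0 ≤ h r) (h0 : 0 < extCI h 0) {r : ℝ}
    (hr : r ∈ Set.Ico (0:ℝ) 1) : 0 < extCI (solOp p N h) r :=
  ctail_pos (inv_sub_one_nonneg hp) (radSlope_pos hp hh h0) hr

lemma solOp_one (hp : 2 < p) (h : CI) : extCI (solOp p N h) 1 = 0 :=
  extCI_ctail_one (inv_sub_one_nonneg hp) _

lemma norm_solOp (hp : 2 < p) {h : CI} (hh : ∀ r, 0 ≤ h r) :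
    ‖solOp p N h‖ = extCI (solOp p N h) 0 := by
  have h0 : 0 ≤ extCI (solOp p N h) 0 := solOp_nonneg hp hh _
  refine le_antisymm ((ContinuousMap.norm_le _ h0).2 fun r => ?_) ?_
  · rw [Real.norm_of_nonneg (solOp_nonneg hp hh r)]
    exact ctail_le_zero (inv_sub_one_nonneg hp) (radSlope_nonneg hp hh) r
  · exact (le_abs_self _).trans (abs_extCI_le _ _)

/-- The solution operator is positively homogeneous of degree `1/(p-1)`. -/
lemma solOp_smul (hp : 2 < p) {h : CI} (hh : ∀ r, 0 ≤ h r) {c : ℝ} (hc : 0 ≤ c) :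
    solOp p N (c ^ (p - 1) • h) = c • solOp p N h := by
  have : radSlope p N (c ^ (p - 1) • h) = c • radSlope p N h := by
    ext r
    rw [radSlope_apply hp, map_smul, ContinuousMap.smul_apply, ContinuousMap.smul_apply,
      radSlope_apply hp, smul_eq_mul, smul_eq_mul, Real.mul_rpow (Real.rpow_nonneg hc _)
      (wavg_nonneg N hh r), Real.rpow_rpow_inv hc (by linarith)]
  rw [solOp, this, map_smul, solOp]

/-- The derivative of `solOp` at `h`, where `d r = (p-1)⁻¹ (wavg N h r)^((p-1)⁻¹-1)`. -/
lemma hasStrictFDerivAt_solOp (hp : 2 < p) {h : CI} (hh : ∀ r, 0 < wavg N h r) :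
    ∃ d : CI, (∀ r, d r = (p - 1)⁻¹ * (wavg N h r) ^ ((p - 1)⁻¹ - 1)) ∧
      HasStrictFDerivAt (solOp p N)
        (ctail (p - 1)⁻¹ ∘L ContinuousLinearMap.mul ℝ CI d ∘L wavg N) h := by
  have hβ := inv_sub_one_nonneg hp
  refine ⟨⟨fun r => (p - 1)⁻¹ * (wavg N h r) ^ ((p - 1)⁻¹ - 1), ?_⟩, fun r => rfl, ?_⟩
  · refine continuous_const.mul ?_
    exact (wavg N h).continuous.rpow_const fun r => Or.inl (hh r).ne'
  · suffices hk : ∀ d : CI, (∀ r, d r = (p - 1)⁻¹ * (wavg N h r) ^ ((p - 1)⁻¹ - 1)) →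
        HasStrictFDerivAt (nem (powFun (p - 1)⁻¹)) (ContinuousLinearMap.mul ℝ CI d)
          (wavg N h) from
      (ctail (p - 1)⁻¹).hasStrictFDerivAt.comp h
        (HasStrictFDerivAt.comp (g := nem (powFun (p - 1)⁻¹)) h (hk _ fun r => rfl)
          (wavg N).hasStrictFDerivAt)
    intro d hd
    refine hasStrictFDerivAt_nem _ (S := Set.Ioi 0) (g' := fun z => (p - 1)⁻¹ *
      z.2 ^ ((p - 1)⁻¹ - 1)) isOpen_Ioi ?_ ?_ _ _ hh hd
    · refine continuousOn_const.mul ?_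
      exact continuousOn_snd.rpow_const fun z hz => Or.inl (ne_of_gt hz.2)
    · intro r x hx
      simp_rw [powFun_apply hβ]
      exact Real.hasDerivAt_rpow_const (Or.inl (ne_of_gt hx))

end solOp

/-! ### Picone's identity -/

lemma eq_zero_of_deriv_nonneg_of_tendsto {F F' : ℝ → ℝ}
    (hd : ∀ r ∈ Set.Ioo (0:ℝ) 1, HasDerivAt F (F' r) r) (hF' : ∀ r ∈ Set.Ioo (0:ℝ) 1, 0 ≤ F' r)
    (h0 : Tendsto F (𝓝[>] 0) (𝓝 0)) (h1 : Tendsto F (𝓝[<] 1) (𝓝 0)) :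
    ∀ r ∈ Set.Ioo (0:ℝ) 1, F r = 0 ∧ F' r = 0 := by
  have hmono : MonotoneOn F (Set.Ioo 0 1) := by
    refine monotoneOn_of_deriv_nonneg (convex_Ioo 0 1)
      (fun r hr => (hd r hr).continuousAt.continuousWithinAt) ?_ ?_
    · rw [interior_Ioo]
      exact fun r hr => (hd r hr).differentiableAt.differentiableWithinAt
    · rw [interior_Ioo]
      exact fun r hr => (hd r hr).deriv ▸ hF' r hr
  have hz : ∀ r ∈ Set.Ioo (0:ℝ) 1, F r = 0 := by
    intro r hr
    refine le_antisymm (ge_of_tendsto h1 ?_) (le_of_tendsto h0 ?_)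
    · filter_upwards [Ioo_mem_nhdsLT hr.2] with s hs
      exact hmono hr ⟨hr.1.trans hs.1, hs.2⟩ hs.1.le
    · filter_upwards [Ioo_mem_nhdsGT hr.1] with s hs
      exact hmono ⟨hs.1, hs.2.trans hr.2⟩ hr hs.2.le
  refine fun r hr => ⟨hz r hr, ?_⟩
  have h2 : F =ᶠ[𝓝 r] fun _ => 0 := by
    filter_upwards [Ioo_mem_nhds hr.1 hr.2] with s hs using hz s hs
  exact (hd r hr).unique ((hasDerivAt_const r (0:ℝ)).congr_of_eventuallyEq h2)

lemma eq_of_hasDerivAt_zero {F : ℝ → ℝ} (hd : ∀ r ∈ Set.Ioo (0:ℝ) 1, HasDerivAt F 0 r)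
    {r s : ℝ} (hr : r ∈ Set.Ioo (0:ℝ) 1) (hs : s ∈ Set.Ioo (0:ℝ) 1) : F r = F s :=
  isOpen_Ioo.is_const_of_deriv_eq_zero (convex_Ioo (0:ℝ) 1).isPreconnected
    (fun r hr => (hd r hr).differentiableAt.differentiableWithinAt)
    (fun r hr => (hd r hr).deriv) hr hs

lemma young_rpow {p s t : ℝ} (hp : 2 < p) (hs : 0 ≤ s) (ht : 0 ≤ t) :
    0 ≤ s ^ p - p * t ^ (p - 1) * s + (p - 1) * t ^ p := by
  have hp1 : 0 < p - 1 := by linarith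
  have hpq : p.HolderConjugate (p / (p - 1)) := Real.HolderConjugate.conjExponent (by linarith)
  have h := Real.young_inequality_of_nonneg hs (Real.rpow_nonneg ht (p - 1)) hpq
  rw [← Real.rpow_mul ht, mul_div_cancel₀ _ hp1.ne'] at h
  have hp0 : 0 < p := by linarith
  have e : p * (s ^ p / p + t ^ p / (p / (p - 1))) = s ^ p + (p - 1) * t ^ p := by
    field_simp
  have := mul_le_mul_of_nonneg_left h hp0.le
  rw [e] at this
  linarith

lemma exists_le_mul {g h : CI} (hh : ∀ r, 0 < h r) : ∃ C, 0 ≤ C ∧ ∀ r, g r ≤ C * h r := by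
  obtain ⟨r0, -, hr0⟩ := isCompact_univ.exists_isMinOn (Set.univ_nonempty)
    (h.continuous.continuousOn (s := Set.univ))
  refine ⟨‖g‖ / h r0, div_nonneg (norm_nonneg _) (hh r0).le, fun r => ?_⟩
  have h1 : h r0 ≤ h r := hr0 (Set.mem_univ r)
  rw [div_mul_eq_mul_div, le_div_iff₀ (hh r0)]
  have h2 : g r ≤ ‖g‖ := (le_abs_self _).trans (g.norm_coe_le_norm r)
  nlinarith [norm_nonneg g, hh r0]

section picone

variable {p : ℝ} {N : ℕ}

/-- The Picone function of the solutions `u`, `v` with right-hand sides `h`, `k`. -/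
def picone (p : ℝ) (N : ℕ) (h k : CI) (r : ℝ) : ℝ :=
  (r ^ N * extCI (wavg N k) r) * (extCI (solOp p N h) r *
    (extCI (solOp p N h) r / extCI (solOp p N k) r) ^ (p - 1)) -
  (r ^ N * extCI (wavg N h) r) * extCI (solOp p N h) r

lemma hasDerivAt_solOp (hp : 2 < p) (h : CI) {r : ℝ} (hr : r ∈ Set.Ioo (0:ℝ) 1) :
    HasDerivAt (extCI (solOp p N h)) (-(r ^ (p - 1)⁻¹ * extCI (radSlope p N h) r)) r :=
  hasDerivAt_ctail (inv_sub_one_nonneg hp) _ hr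

/-- The remainder in Picone's identity. -/
def piconeRem (p : ℝ) (N : ℕ) (h k : CI) (r : ℝ) : ℝ :=
  r ^ N * r ^ (p - 1)⁻¹ * (extCI (radSlope p N h) r ^ p
    - p * (extCI (solOp p N h) r / extCI (solOp p N k) r * extCI (radSlope p N k) r) ^ (p - 1)
      * extCI (radSlope p N h) r
    + (p - 1) * (extCI (solOp p N h) r / extCI (solOp p N k) r * extCI (radSlope p N k) r) ^ p)

variable {h k : CI}

lemma piconeRem_nonneg (hp : 2 < p) (hh : ∀ r, 0 ≤ h r) (hk : ∀ r, 0 ≤ k r) {r : ℝ}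
    (hr : 0 ≤ r) : 0 ≤ piconeRem p N h k r := by
  refine mul_nonneg (mul_nonneg (pow_nonneg hr _) (Real.rpow_nonneg hr _)) (young_rpow hp ?_ ?_)
  · exact radSlope_nonneg hp hh _
  · exact mul_nonneg (div_nonneg (solOp_nonneg hp hh _) (solOp_nonneg hp hk _))
      (radSlope_nonneg hp hk _)

lemma hasDerivAt_picone (hp : 2 < p) (hN : 1 ≤ N) (hh : ∀ r, 0 ≤ h r) (hh0 : 0 < extCI h 0)
    (hk : ∀ r, 0 ≤ k r) (hk0 : 0 < extCI k 0) {r : ℝ} (hr : r ∈ Set.Ioo (0:ℝ) 1) :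
    HasDerivAt (picone p N h k) (r ^ (N - 1) * extCI (solOp p N h) r *
      (extCI k r * (extCI (solOp p N h) r / extCI (solOp p N k) r) ^ (p - 1) - extCI h r)
      + piconeRem p N h k r) r := by
  have hu : 0 < extCI (solOp p N h) r := solOp_pos hp hh hh0 ⟨hr.1.le, hr.2⟩
  have hv : 0 < extCI (solOp p N k) r := solOp_pos hp hk hk0 ⟨hr.1.le, hr.2⟩
  have hy : 0 < extCI (radSlope p N h) r := radSlope_pos hp hh hh0 _
  have hx : 0 < extCI (radSlope p N k) r := radSlope_pos hp hk hk0 _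
  have du := hasDerivAt_solOp (N := N) hp h hr
  have dv := hasDerivAt_solOp (N := N) hp k hr
  have dMh := hasDerivAt_pow_mul_wavg hN h hr
  have dMk := hasDerivAt_pow_mul_wavg hN k hr
  have hρ : 0 < extCI (solOp p N h) r / extCI (solOp p N k) r := div_pos hu hv
  have dρ := (du.div dv hv.ne').rpow_const (p := p - 1) (Or.inl hρ.ne')
  have dP := (dMk.mul (du.mul dρ)).sub (dMh.mul du)
  refine dP.congr_deriv ?_
  simp only [Pi.mul_apply, Pi.div_apply]
  unfold piconeRem
  have eh := extCI_radSlope_rpow (N := N) hp hh r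
  have ek := extCI_radSlope_rpow (N := N) hp hk r
  rw [← eh, ← ek]
  set u := extCI (solOp p N h) r
  set v := extCI (solOp p N k) r
  set y := extCI (radSlope p N h) r
  set x := extCI (radSlope p N k) r
  rw [Real.mul_rpow hρ.le hx.le, Real.mul_rpow hρ.le hx.le]
  have e1 : ∀ {z : ℝ}, 0 < z → z ^ p = z * z ^ (p - 1) := fun {z} hz => by
    rw [Real.rpow_sub_one hz.ne']; field_simp
  have e2 : (u / v) ^ (p - 1 - 1) = (u / v) ^ (p - 1) / (u / v) := Real.rpow_sub_one hρ.ne' _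
  rw [e1 hy, e1 hx, e1 hρ, e2]
  generalize (u / v) ^ (p - 1) = R
  generalize y ^ (p - 1) = Y
  generalize x ^ (p - 1) = X
  field_simp
  ring

lemma exists_picone_bound (hp : 2 < p) (hh : ∀ r, 0 ≤ h r) (hh0 : 0 < extCI h 0)
    (hk : ∀ r, 0 ≤ k r) (hk0 : 0 < extCI k 0) :
    ∃ C, ∀ r ∈ Set.Ioo (0:ℝ) 1, |picone p N h k r| ≤ C * (r ^ N * extCI (solOp p N h) r) := by
  obtain ⟨C, hC0, hC⟩ := exists_le_mul (g := radSlope p N h) (radSlope_pos (N := N) hp hk hk0)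
  have hβ := inv_sub_one_nonneg hp
  have hCv : ∀ r : Set.Icc (0:ℝ) 1, solOp p N h r ≤ C * solOp p N k r := by
    intro r
    have h1 := ctail_mono hβ (g := radSlope p N h) (h := C • radSlope p N k)
      (fun r => by simpa using hC r) r
    rw [map_smul] at h1
    exact h1
  refine ⟨‖wavg N k‖ * C ^ (p - 1) + ‖wavg N h‖, fun r hr => ?_⟩
  have hu : 0 < extCI (solOp p N h) r := solOp_pos hp hh hh0 ⟨hr.1.le, hr.2⟩
  have hv : 0 < extCI (solOp p N k) r := solOp_pos hp hk hk0 ⟨hr.1.le, hr.2⟩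
  have hρ : 0 ≤ extCI (solOp p N h) r / extCI (solOp p N k) r := (div_pos hu hv).le
  have hρC : extCI (solOp p N h) r / extCI (solOp p N k) r ≤ C := by
    rw [div_le_iff₀ hv]
    exact hCv (Set.projIcc 0 1 zero_le_one r)
  have hR := Real.rpow_le_rpow hρ hρC (show 0 ≤ p - 1 by linarith)
  have hR0 := Real.rpow_nonneg hρ (p - 1)
  have hrN : 0 < r ^ N := pow_pos hr.1 _
  have e : picone p N h k r = (extCI (wavg N k) r *
      (extCI (solOp p N h) r / extCI (solOp p N k) r) ^ (p - 1) - extCI (wavg N h) r) *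
      (r ^ N * extCI (solOp p N h) r) := by
    unfold picone; ring
  rw [e, abs_mul, abs_of_pos (mul_pos hrN hu)]
  refine mul_le_mul_of_nonneg_right ?_ (mul_pos hrN hu).le
  refine (abs_sub _ _).trans (add_le_add ?_ (abs_extCI_le _ _))
  rw [abs_mul, abs_of_nonneg hR0]
  exact mul_le_mul (abs_extCI_le _ _) hR hR0 (norm_nonneg _)

lemma tendsto_pow_mul_solOp (hp : 2 < p) (hN : 1 ≤ N) (h : CI) (C : ℝ) :
    Tendsto (fun r => C * (r ^ N * extCI (solOp p N h) r)) (𝓝[>] 0) (𝓝 0) ∧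
    Tendsto (fun r => C * (r ^ N * extCI (solOp p N h) r)) (𝓝[<] 1) (𝓝 0) := by
  have hc : Continuous fun r => C * (r ^ N * extCI (solOp p N h) r) := by
    have := continuous_extCI (solOp p N h)
    fun_prop
  constructor
  · have := (hc.tendsto 0).mono_left (nhdsWithin_le_nhds (s := Set.Ioi 0))
    simpa [show N ≠ 0 by omega] using this
  · have := (hc.tendsto 1).mono_left (nhdsWithin_le_nhds (s := Set.Iio 1))
    simpa [solOp_one hp] using this

lemma tendsto_picone (hp : 2 < p) (hN : 1 ≤ N) (hh : ∀ r, 0 ≤ h r) (hh0 : 0 < extCI h 0)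
    (hk : ∀ r, 0 ≤ k r) (hk0 : 0 < extCI k 0) :
    Tendsto (picone p N h k) (𝓝[>] 0) (𝓝 0) ∧ Tendsto (picone p N h k) (𝓝[<] 1) (𝓝 0) := by
  obtain ⟨C, hC⟩ := exists_picone_bound (N := N) hp hh hh0 hk hk0
  obtain ⟨t0, t1⟩ := tendsto_pow_mul_solOp hp hN h C
  constructor
  · refine squeeze_zero_norm' ?_ t0
    filter_upwards [Ioo_mem_nhdsGT (zero_lt_one (α := ℝ))] with r hr using hC r hr
  · refine squeeze_zero_norm' ?_ t1
    filter_upwards [Ioo_mem_nhdsLT (zero_lt_one (α := ℝ))] with r hr using hC r hr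

/-- Comparison of weights: if `u`, `v` are positive solutions of the half-linear equations with
weights `a ≤ b`, then `a = b`. -/
theorem weight_eq_of_le (hp : 2 < p) (hN : 1 ≤ N) (hh : ∀ r, 0 ≤ h r) (hh0 : 0 < extCI h 0)
    (hk : ∀ r, 0 ≤ k r) (hk0 : 0 < extCI k 0) {a b : ℝ → ℝ}
    (ha : ∀ r ∈ Set.Ioo (0:ℝ) 1, extCI h r = a r * extCI (solOp p N h) r ^ (p - 1))
    (hb : ∀ r ∈ Set.Ioo (0:ℝ) 1, extCI k r = b r * extCI (solOp p N k) r ^ (p - 1))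
    (hab : ∀ r ∈ Set.Ioo (0:ℝ) 1, a r ≤ b r) : ∀ r ∈ Set.Ioo (0:ℝ) 1, a r = b r := by
  have hpos : ∀ r ∈ Set.Ioo (0:ℝ) 1, 0 < extCI (solOp p N h) r ∧ 0 < extCI (solOp p N k) r :=
    fun r hr => ⟨solOp_pos hp hh hh0 ⟨hr.1.le, hr.2⟩, solOp_pos hp hk hk0 ⟨hr.1.le, hr.2⟩⟩
  have e : ∀ r ∈ Set.Ioo (0:ℝ) 1, extCI k r *
      (extCI (solOp p N h) r / extCI (solOp p N k) r) ^ (p - 1) - extCI h r =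
      (b r - a r) * extCI (solOp p N h) r ^ (p - 1) := by
    intro r hr
    obtain ⟨hu, hv⟩ := hpos r hr
    have := (Real.rpow_pos_of_pos hv (p - 1)).ne'
    rw [ha r hr, hb r hr, Real.div_rpow hu.le hv.le]
    field_simp
  obtain ⟨t0, t1⟩ := tendsto_picone hp hN hh hh0 hk hk0
  have main := eq_zero_of_deriv_nonneg_of_tendsto
    (fun r hr => hasDerivAt_picone hp hN hh hh0 hk hk0 hr) (fun r hr => ?_) t0 t1
  · intro r hr
    have h1 := (main r hr).2
    obtain ⟨hu, hv⟩ := hpos r hr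
    have h2 := piconeRem_nonneg (N := N) hp hh hk hr.1.le
    have h4 : 0 < r ^ (N - 1) * extCI (solOp p N h) r := mul_pos (pow_pos hr.1 _) hu
    have hq := Real.rpow_pos_of_pos hu (p - 1)
    rw [e r hr] at h1
    by_contra hne
    have h3 : 0 < b r - a r := sub_pos.2 (lt_of_le_of_ne (hab r hr) hne)
    have := mul_pos h4 (mul_pos h3 hq)
    linarith
  · obtain ⟨hu, hv⟩ := hpos r hr
    rw [e r hr]
    refine add_nonneg (mul_nonneg (mul_nonneg (pow_nonneg hr.1.le _) hu.le)
      (mul_nonneg (sub_nonneg.2 (hab r hr)) (Real.rpow_nonneg hu.le _)))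
      (piconeRem_nonneg hp hh hk hr.1.le)


lemma CI_ext_of_Ioo {u v : CI} (huv : ∀ r ∈ Set.Ioo (0:ℝ) 1, extCI u r = extCI v r) : u = v := by
  have h1 : Set.EqOn (extCI u) (extCI v) (closure (Set.Ioo 0 1)) :=
    Set.EqOn.closure huv (continuous_extCI u) (continuous_extCI v)
  rw [closure_Ioo zero_ne_one] at h1
  ext r
  rw [← extCI_coe, ← extCI_coe]
  exact h1 r.2

/-- Two positive solutions coincide if the weights are ordered opposite to the solutions. -/
theorem solOp_eq_of_weights (hp : 2 < p) (hN : 1 ≤ N) (hh : ∀ r, 0 ≤ h r) (hh0 : 0 < extCI h 0)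
    (hk : ∀ r, 0 ≤ k r) (hk0 : 0 < extCI k 0) {a b : ℝ → ℝ}
    (ha : ∀ r ∈ Set.Ioo (0:ℝ) 1, extCI h r = a r * extCI (solOp p N h) r ^ (p - 1))
    (hb : ∀ r ∈ Set.Ioo (0:ℝ) 1, extCI k r = b r * extCI (solOp p N k) r ^ (p - 1))
    (h1 : ∀ r ∈ Set.Ioo (0:ℝ) 1, extCI (solOp p N h) r < extCI (solOp p N k) r → b r ≤ a r)
    (h2 : ∀ r ∈ Set.Ioo (0:ℝ) 1, extCI (solOp p N k) r < extCI (solOp p N h) r → a r ≤ b r)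
    {c : ℝ} (hc : c < 1) (h3 : ∀ r ∈ Set.Ioo c 1, 0 < r →
      extCI (solOp p N h) r ≠ extCI (solOp p N k) r → a r ≠ b r) :
    solOp p N h = solOp p N k := by
  have hp0 : 0 < p := by linarith
  have hpos : ∀ r ∈ Set.Ioo (0:ℝ) 1, 0 < extCI (solOp p N h) r ∧ 0 < extCI (solOp p N k) r :=
    fun r hr => ⟨solOp_pos hp hh hh0 ⟨hr.1.le, hr.2⟩, solOp_pos hp hk hk0 ⟨hr.1.le, hr.2⟩⟩
  have hsq : ∀ {z : ℝ}, 0 < z → z ^ p = z * z ^ (p - 1) := fun {z} hz => by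
    rw [Real.rpow_sub_one hz.ne']; field_simp
  have e : ∀ r ∈ Set.Ioo (0:ℝ) 1, r ^ (N - 1) * extCI (solOp p N h) r *
      (extCI k r * (extCI (solOp p N h) r / extCI (solOp p N k) r) ^ (p - 1) - extCI h r) +
      r ^ (N - 1) * extCI (solOp p N k) r *
      (extCI h r * (extCI (solOp p N k) r / extCI (solOp p N h) r) ^ (p - 1) - extCI k r) =
      r ^ (N - 1) * ((b r - a r) * (extCI (solOp p N h) r ^ p - extCI (solOp p N k) r ^ p)) := by
    intro r hr
    obtain ⟨hu, hv⟩ := hpos r hr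
    have := (Real.rpow_pos_of_pos hv (p - 1)).ne'
    have := (Real.rpow_pos_of_pos hu (p - 1)).ne'
    rw [ha r hr, hb r hr, Real.div_rpow hu.le hv.le, Real.div_rpow hv.le hu.le, hsq hu, hsq hv]
    field_simp
    ring
  have hsgn : ∀ r ∈ Set.Ioo (0:ℝ) 1,
      0 ≤ (b r - a r) * (extCI (solOp p N h) r ^ p - extCI (solOp p N k) r ^ p) := by
    intro r hr
    obtain ⟨hu, hv⟩ := hpos r hr
    rcases lt_trichotomy (extCI (solOp p N h) r) (extCI (solOp p N k) r) with h | h | h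
    · exact mul_nonneg_of_nonpos_of_nonpos (sub_nonpos.2 (h1 r hr h))
        (sub_nonpos.2 (Real.rpow_le_rpow hu.le h.le hp0.le))
    · rw [h, sub_self, mul_zero]
    · exact mul_nonneg (sub_nonneg.2 (h2 r hr h))
        (sub_nonneg.2 (Real.rpow_le_rpow hv.le h.le hp0.le))
  obtain ⟨t0, t1⟩ := tendsto_picone hp hN hh hh0 hk hk0
  obtain ⟨t0', t1'⟩ := tendsto_picone hp hN hk hk0 hh hh0
  have rem1 : ∀ r ∈ Set.Ioo (0:ℝ) 1, 0 ≤ piconeRem p N h k r :=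
    fun r hr => piconeRem_nonneg hp hh hk hr.1.le
  have rem2 : ∀ r ∈ Set.Ioo (0:ℝ) 1, 0 ≤ piconeRem p N k h r :=
    fun r hr => piconeRem_nonneg hp hk hh hr.1.le
  have s0 := t0.add t0'
  have s1 := t1.add t1'
  rw [add_zero] at s0 s1
  have main := eq_zero_of_deriv_nonneg_of_tendsto
    (fun r hr => (hasDerivAt_picone hp hN hh hh0 hk hk0 hr).add
      (hasDerivAt_picone hp hN hk hk0 hh hh0 hr)) (fun r hr => ?_) s0 s1
  swap
  · have := mul_nonneg (pow_nonneg hr.1.le (N - 1)) (hsgn r hr)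
    linarith [e r hr, rem1 r hr, rem2 r hr]
  have hnear : ∀ r ∈ Set.Ioo c 1, 0 < r → extCI (solOp p N h) r = extCI (solOp p N k) r := by
    intro r hr hr0
    by_contra hne
    have hr' : r ∈ Set.Ioo (0:ℝ) 1 := ⟨hr0, hr.2⟩
    obtain ⟨hu, hv⟩ := hpos r hr'
    have h4 : (b r - a r) * (extCI (solOp p N h) r ^ p - extCI (solOp p N k) r ^ p) ≠ 0 :=
      mul_ne_zero (sub_ne_zero.2 (h3 r hr hr0 hne).symm) (sub_ne_zero.2 fun h =>
        hne ((Real.rpow_left_inj hu.le hv.le hp0.ne').1 h))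
    have h5 := mul_pos (pow_pos hr0 (N - 1)) ((hsgn r hr').lt_of_ne h4.symm)
    linarith [e r hr', rem1 r hr', rem2 r hr', (main r hr').2]
  have hD : ∀ r ∈ Set.Ioo (0:ℝ) 1, HasDerivAt
      (fun r => (extCI (solOp p N h) r / extCI (solOp p N k) r - 1) ^ 2) 0 r := by
    intro r hr
    obtain ⟨hu, hv⟩ := hpos r hr
    have hx : 0 < extCI (radSlope p N k) r := radSlope_pos hp hk hk0 _
    have hy : 0 < extCI (radSlope p N h) r := radSlope_pos hp hh hh0 _
    have dρ := (((hasDerivAt_solOp (N := N) hp h hr).div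
      (hasDerivAt_solOp (N := N) hp k hr) hv.ne').sub_const 1).pow 2
    refine dρ.congr_deriv ?_
    have h4 := (main r hr).1
    simp only [Pi.add_apply, picone] at h4
    rw [← extCI_radSlope_rpow hp hh, ← extCI_radSlope_rpow hp hk] at h4
    simp only [Pi.div_apply]
    set u := extCI (solOp p N h) r
    set v := extCI (solOp p N k) r
    set y := extCI (radSlope p N h) r
    set x := extCI (radSlope p N k) r
    have hU := Real.rpow_pos_of_pos hu (p - 1)
    have hV := Real.rpow_pos_of_pos hv (p - 1)
    have hrN := pow_pos hr.1 N
    have h5 : (u ^ p - v ^ p) * ((u * x) ^ (p - 1) - (v * y) ^ (p - 1)) = 0 := by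
      rw [Real.div_rpow hu.le hv.le, Real.div_rpow hv.le hu.le] at h4
      rw [Real.mul_rpow hu.le hx.le, Real.mul_rpow hv.le hy.le, hsq hu, hsq hv]
      have h6 : r ^ N * ((u * u ^ (p - 1) - v * v ^ (p - 1)) * (u ^ (p - 1) * x ^ (p - 1) -
          v ^ (p - 1) * y ^ (p - 1))) = 0 := by
        field_simp at h4
        linarith
      exact (mul_eq_zero.1 h6).resolve_left hrN.ne'
    rcases mul_eq_zero.1 h5 with h6 | h6
    · have : u = v := (Real.rpow_left_inj hu.le hv.le hp0.ne').1 (sub_eq_zero.1 h6)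
      rw [this, div_self hv.ne']
      simp
    · have : u * x = v * y := (Real.rpow_left_inj (mul_pos hu hx).le (mul_pos hv hy).le
        (by linarith : p - 1 ≠ 0)).1 (sub_eq_zero.1 h6)
      have h7 : -(r ^ (p - 1)⁻¹ * y) * v - u * -(r ^ (p - 1)⁻¹ * x) = 0 := by
        linear_combination r ^ (p - 1)⁻¹ * this
      rw [h7]
      simp
  refine CI_ext_of_Ioo fun r hr => ?_
  obtain ⟨s, hs1, hs2⟩ := exists_between (max_lt zero_lt_one hc : max 0 c < 1)
  have hs0 : 0 < s := (le_max_left _ _).trans_lt hs1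
  have h4 := eq_of_hasDerivAt_zero hD hr ⟨hs0, hs2⟩
  have h5 := hnear s ⟨(le_max_right _ _).trans_lt hs1, hs2⟩ hs0
  rw [h5, div_self (hpos s ⟨hs0, hs2⟩).2.ne', sub_self, zero_pow two_ne_zero] at h4
  have h6 := sub_eq_zero.1 (pow_eq_zero_iff two_ne_zero |>.1 h4)
  exact (div_eq_one_iff_eq (hpos r hr).2.ne').1 h6

end picone

/-! ### Nondegeneracy and the implicit function theorem -/

section nondegenerate

variable {p : ℝ} {N : ℕ} {h k d : CI}

/-- The linearized problem at a positive solution has only the trivial solution. -/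
theorem linearized_eq_zero (hp : 2 < p) (hN : 1 ≤ N) (hh : ∀ r, 0 ≤ h r) (hh0 : 0 < extCI h 0)
    (hd : ∀ r, d r = (p - 1)⁻¹ * (wavg N h r) ^ ((p - 1)⁻¹ - 1)) {q : ℝ → ℝ}
    (hk : ∀ r ∈ Set.Ioo (0:ℝ) 1, extCI k r = q r * extCI (ctail (p - 1)⁻¹ (d * wavg N k)) r)
    (hq : ∀ r ∈ Set.Ioo (0:ℝ) 1, q r * extCI (solOp p N h) r ≤ (p - 1) * extCI h r)
    {c : ℝ} (hc : c < 1)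
    (hq' : ∀ r ∈ Set.Ioo c 1, 0 < r → q r * extCI (solOp p N h) r < (p - 1) * extCI h r) :
    ctail (p - 1)⁻¹ (d * wavg N k) = 0 := by
  have hβ := inv_sub_one_nonneg hp
  have hp1 : 0 < p - 1 := by linarith
  set g : CI := d * wavg N k with hg
  have hu : ∀ r ∈ Set.Ioo (0:ℝ) 1, 0 < extCI (solOp p N h) r :=
    fun r hr => solOp_pos hp hh hh0 ⟨hr.1.le, hr.2⟩
  obtain ⟨C₁, hC₁, hb₁⟩ := exists_le_mul (g := g) (radSlope_pos (N := N) hp hh hh0)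
  obtain ⟨C₂, hC₂, hb₂⟩ := exists_le_mul (g := -g) (radSlope_pos (N := N) hp hh hh0)
  have hw : ∀ r ∈ Set.Ioo (0:ℝ) 1,
      |extCI (ctail (p - 1)⁻¹ g) r| ≤ (C₁ + C₂) * extCI (solOp p N h) r := by
    intro r hr
    have h1 := ctail_mono hβ (g := g) (h := C₁ • radSlope p N h) hb₁ (Set.projIcc 0 1 zero_le_one r)
    have h2 := ctail_mono hβ (g := -g) (h := C₂ • radSlope p N h) hb₂
      (Set.projIcc 0 1 zero_le_one r)
    rw [map_smul] at h1 h2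
    rw [map_neg] at h2
    replace h1 : extCI (ctail (p - 1)⁻¹ g) r ≤ C₁ * extCI (solOp p N h) r := h1
    replace h2 : -extCI (ctail (p - 1)⁻¹ g) r ≤ C₂ * extCI (solOp p N h) r := h2
    have := hu r hr
    rw [abs_le]
    constructor <;> nlinarith
  set w := extCI (ctail (p - 1)⁻¹ g) with hwdef
  let Q : ℝ → ℝ := fun r => (p - 1) * ((r ^ N * extCI (wavg N h) r) *
    (w r ^ 2 / extCI (solOp p N h) r)) - (r ^ N * extCI (wavg N k) r) * w r
  have hQd : ∀ r ∈ Set.Ioo (0:ℝ) 1, HasDerivAt Q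
      (r ^ (N - 1) * (w r ^ 2 / extCI (solOp p N h) r * ((p - 1) * extCI h r -
        q r * extCI (solOp p N h) r)) + r ^ N * r ^ (p - 1)⁻¹ * ((p - 1) * extCI (wavg N h) r /
        extCI (radSlope p N h) r) * (extCI g r - w r * extCI (radSlope p N h) r /
        extCI (solOp p N h) r) ^ 2) r := by
    intro r hr
    have du := hasDerivAt_solOp (N := N) hp h hr
    have dw : HasDerivAt w (-(r ^ (p - 1)⁻¹ * extCI g r)) r := hasDerivAt_ctail hβ g hr
    have dMh := hasDerivAt_pow_mul_wavg hN h hr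
    have dMk := hasDerivAt_pow_mul_wavg hN k hr
    have hu0 := hu r hr
    refine (((dMh.mul ((dw.pow 2).div du hu0.ne')).const_mul (p - 1)).sub
      (dMk.mul dw)).congr_deriv ?_
    rw [hk r hr]
    have hm : 0 < extCI (wavg N h) r := wavg_pos N hh hh0 _
    have hy : 0 < extCI (radSlope p N h) r := radSlope_pos hp hh hh0 _
    have e1 : extCI g r = extCI d r * extCI (wavg N k) r := rfl
    have e2 : extCI d r = (p - 1)⁻¹ * (extCI (wavg N h) r) ^ ((p - 1)⁻¹ - 1) := hd _
    have e3 : extCI (radSlope p N h) r = (extCI (wavg N h) r) ^ (p - 1)⁻¹ := radSlope_apply hp h _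
    rw [Real.rpow_sub_one hm.ne', ← e3] at e2
    rw [e2] at e1
    have e4 : extCI (wavg N k) r = (p - 1) * extCI (wavg N h) r * extCI g r /
        extCI (radSlope p N h) r := by
      rw [e1]; field_simp
    simp only [Pi.div_apply, Pi.pow_apply]
    rw [e4]
    change _ = r ^ (N - 1) * (w r ^ 2 / extCI (solOp p N h) r * ((p - 1) * extCI h r -
        q r * extCI (solOp p N h) r)) + _
    clear_value w g
    generalize extCI (solOp p N h) r = u at *
    generalize extCI (radSlope p N h) r = y at *
    generalize extCI (wavg N h) r = m at *
    generalize r ^ (p - 1)⁻¹ = R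
    field_simp
    ring
  have hnn : ∀ r ∈ Set.Ioo (0:ℝ) 1, 0 ≤ r ^ (N - 1) * (w r ^ 2 / extCI (solOp p N h) r *
      ((p - 1) * extCI h r - q r * extCI (solOp p N h) r)) := fun r hr =>
    mul_nonneg (pow_nonneg hr.1.le _) (mul_nonneg (div_nonneg (sq_nonneg _) (hu r hr).le)
      (sub_nonneg.2 (hq r hr)))
  have hcoef : ∀ r ∈ Set.Ioo (0:ℝ) 1, 0 < r ^ N * r ^ (p - 1)⁻¹ *
      ((p - 1) * extCI (wavg N h) r / extCI (radSlope p N h) r) := fun r hr =>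
    mul_pos (mul_pos (pow_pos hr.1 _) (Real.rpow_pos_of_pos hr.1 _))
      (div_pos (mul_pos hp1 (wavg_pos N hh hh0 _)) (radSlope_pos hp hh hh0 _))
  have hnn2 : ∀ r ∈ Set.Ioo (0:ℝ) 1, 0 ≤ r ^ N * r ^ (p - 1)⁻¹ * ((p - 1) *
      extCI (wavg N h) r / extCI (radSlope p N h) r) * (extCI g r - w r *
      extCI (radSlope p N h) r / extCI (solOp p N h) r) ^ 2 := fun r hr =>
    mul_nonneg (hcoef r hr).le (sq_nonneg _)
  have hQb : ∀ r ∈ Set.Ioo (0:ℝ) 1, ‖Q r‖ ≤ ((p - 1) * ‖wavg N h‖ * (C₁ + C₂) ^ 2 +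
      ‖wavg N k‖ * (C₁ + C₂)) * (r ^ N * extCI (solOp p N h) r) := by
    intro r hr
    have hu0 := hu r hr
    have hrN := pow_pos hr.1 N
    have h1 := hw r hr
    have h2 : w r ^ 2 / extCI (solOp p N h) r ≤ (C₁ + C₂) ^ 2 * extCI (solOp p N h) r := by
      rw [div_le_iff₀ hu0, ← sq_abs (w r)]
      have := pow_le_pow_left₀ (abs_nonneg _) h1 2
      nlinarith
    have h3 : 0 ≤ w r ^ 2 / extCI (solOp p N h) r := div_nonneg (sq_nonneg _) hu0.le
    have e : Q r = r ^ N * ((p - 1) * (extCI (wavg N h) r * (w r ^ 2 / extCI (solOp p N h) r)) -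
      extCI (wavg N k) r * w r) := by simp only [Q]; ring
    rw [Real.norm_eq_abs, e, abs_mul, abs_of_pos hrN]
    have h4 : |(p - 1) * (extCI (wavg N h) r * (w r ^ 2 / extCI (solOp p N h) r))| ≤
        (p - 1) * (‖wavg N h‖ * ((C₁ + C₂) ^ 2 * extCI (solOp p N h) r)) := by
      rw [abs_mul, abs_of_pos hp1, abs_mul, abs_of_nonneg h3]
      exact mul_le_mul_of_nonneg_left (mul_le_mul (abs_extCI_le _ _) h2 h3 (norm_nonneg _)) hp1.le
    have h5 : |extCI (wavg N k) r * w r| ≤ ‖wavg N k‖ * ((C₁ + C₂) * extCI (solOp p N h) r) := by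
      rw [abs_mul]
      exact mul_le_mul (abs_extCI_le _ _) h1 (abs_nonneg _) (norm_nonneg _)
    have h6 := abs_sub ((p - 1) * (extCI (wavg N h) r * (w r ^ 2 / extCI (solOp p N h) r)))
      (extCI (wavg N k) r * w r)
    calc _ ≤ r ^ N * ((p - 1) * (‖wavg N h‖ * ((C₁ + C₂) ^ 2 * extCI (solOp p N h) r)) +
          ‖wavg N k‖ * ((C₁ + C₂) * extCI (solOp p N h) r)) :=
          mul_le_mul_of_nonneg_left (h6.trans (add_le_add h4 h5)) hrN.le
      _ = _ := by ring
  obtain ⟨t0, t1⟩ := tendsto_pow_mul_solOp hp hN h ((p - 1) * ‖wavg N h‖ * (C₁ + C₂) ^ 2 +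
      ‖wavg N k‖ * (C₁ + C₂))
  have main := eq_zero_of_deriv_nonneg_of_tendsto hQd
    (fun r hr => add_nonneg (hnn r hr) (hnn2 r hr))
    (squeeze_zero_norm' (by
      filter_upwards [Ioo_mem_nhdsGT (zero_lt_one (α := ℝ))] with r hr using hQb r hr) t0)
    (squeeze_zero_norm' (by
      filter_upwards [Ioo_mem_nhdsLT (zero_lt_one (α := ℝ))] with r hr using hQb r hr) t1)
  have hD : ∀ r ∈ Set.Ioo (0:ℝ) 1, HasDerivAt (fun r => w r / extCI (solOp p N h) r) 0 r := by
    intro r hr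
    have hu0 := hu r hr
    have dw : HasDerivAt w (-(r ^ (p - 1)⁻¹ * extCI g r)) r := hasDerivAt_ctail hβ g hr
    refine (dw.div (hasDerivAt_solOp (N := N) hp h hr) hu0.ne').congr_deriv ?_
    have h1 := (add_eq_zero_iff_of_nonneg (hnn r hr) (hnn2 r hr)).1 (main r hr).2
    have h2 := (mul_eq_zero.1 h1.2).resolve_left (hcoef r hr).ne'
    rw [pow_eq_zero_iff two_ne_zero, sub_eq_zero] at h2
    rw [h2]
    field_simp
    ring
  refine CI_ext_of_Ioo fun r hr => ?_
  obtain ⟨s, hs1, hs2⟩ := exists_between (max_lt zero_lt_one hc : max 0 c < 1)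
  have hs0 : 0 < s := (le_max_left _ _).trans_lt hs1
  have h1 := (add_eq_zero_iff_of_nonneg (hnn s ⟨hs0, hs2⟩) (hnn2 s ⟨hs0, hs2⟩)).1
    (main s ⟨hs0, hs2⟩).2
  have h2 := (mul_eq_zero.1 h1.1).resolve_left (pow_pos hs0 _).ne'
  have h3 := (mul_eq_zero.1 h2).resolve_right
    (sub_pos.2 (hq' s ⟨(le_max_right _ _).trans_lt hs1, hs2⟩ hs0)).ne'
  have h4 : w s = 0 := by
    rcases div_eq_zero_iff.1 h3 with h | h
    · exact (pow_eq_zero_iff two_ne_zero).1 h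
    · exact absurd h (hu s ⟨hs0, hs2⟩).ne'
  have h5 := eq_of_hasDerivAt_zero hD hr ⟨hs0, hs2⟩
  rw [h4, zero_div, div_eq_zero_iff] at h5
  exact h5.resolve_right (hu r hr).ne'

/-- Positive solutions of the two-parameter problem are locally given by an implicit function. -/
theorem exists_local_branch (hp : 2 < p) (hN : 1 ≤ N) (F F₂ : C(Set.Icc (0:ℝ) 1 × ℝ, ℝ))
    (hF : ∀ r x, HasDerivAt (fun t => F (r, t)) (F₂ (r, x)) x) (z₀ : ℝ × ℝ) {u : CI}
    (hu : u = solOp p N (z₀.1 • 1 + z₀.2 • nem F u))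
    (hh : ∀ r, 0 ≤ (z₀.1 • 1 + z₀.2 • nem F u : CI) r)
    (hh0 : 0 < extCI (z₀.1 • 1 + z₀.2 • nem F u) 0)
    (hq : ∀ r, z₀.2 * F₂ (r, u r) * u r ≤ (p - 1) * (z₀.1 • 1 + z₀.2 • nem F u : CI) r)
    {c : ℝ} (hc : c < 1) (hq' : ∀ r : Set.Icc (0:ℝ) 1, c < r → (r : ℝ) < 1 →
      z₀.2 * F₂ (r, u r) * u r < (p - 1) * (z₀.1 • 1 + z₀.2 • nem F u : CI) r) :
    ∃ ψ : ℝ × ℝ → CI, ∃ ψ' : ℝ × ℝ →L[ℝ] CI, HasStrictFDerivAt ψ ψ' z₀ ∧ ψ z₀ = u ∧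
      ∀ᶠ z in 𝓝 z₀, ψ z = solOp p N (z.1 • 1 + z.2 • nem F (ψ z)) := by
  have hβ := inv_sub_one_nonneg hp
  set h : CI := z₀.1 • 1 + z₀.2 • nem F u with hdef
  obtain ⟨d, hd, hS⟩ := hasStrictFDerivAt_solOp (N := N) hp (h := h) (wavg_pos N hh hh0)
  have hnem := hasStrictFDerivAt_nem F (g' := F₂) isOpen_univ F₂.continuous.continuousOn
    (fun r x _ => hF r x) u (nem F₂ u) (fun _ => Set.mem_univ _) (fun _ => rfl)
  have h1 : HasStrictFDerivAt (fun y : (ℝ × ℝ) × CI => y.1.1 • (1 : CI) + y.1.2 • nem F y.2)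
      ((((ContinuousLinearMap.fst ℝ ℝ ℝ).smulRight (1 : CI)) ∘L
          ContinuousLinearMap.fst ℝ (ℝ × ℝ) CI) +
        (z₀.2 • (ContinuousLinearMap.mul ℝ CI (nem F₂ u) ∘L ContinuousLinearMap.snd ℝ (ℝ × ℝ) CI) +
          ((ContinuousLinearMap.snd ℝ ℝ ℝ) ∘L
            ContinuousLinearMap.fst ℝ (ℝ × ℝ) CI).smulRight (nem F u))) (z₀, u) := by
    refine HasStrictFDerivAt.add ?_ ?_
    · exact ContinuousLinearMap.hasStrictFDerivAt
        (((ContinuousLinearMap.fst ℝ ℝ ℝ).smulRight (1 : CI)) ∘L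
          ContinuousLinearMap.fst ℝ (ℝ × ℝ) CI)
    · have ha : HasStrictFDerivAt (fun y : (ℝ × ℝ) × CI => y.1.2)
          ((ContinuousLinearMap.snd ℝ ℝ ℝ) ∘L ContinuousLinearMap.fst ℝ (ℝ × ℝ) CI) (z₀, u) :=
        ContinuousLinearMap.hasStrictFDerivAt
          ((ContinuousLinearMap.snd ℝ ℝ ℝ) ∘L ContinuousLinearMap.fst ℝ (ℝ × ℝ) CI)
      have hb : HasStrictFDerivAt (fun y : (ℝ × ℝ) × CI => nem F y.2)
          (ContinuousLinearMap.mul ℝ CI (nem F₂ u) ∘L ContinuousLinearMap.snd ℝ (ℝ × ℝ) CI)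
          (z₀, u) :=
        HasStrictFDerivAt.comp (g := nem F) (z₀, u) hnem hasStrictFDerivAt_snd
      exact ha.smul hb
  have h2 := (hasStrictFDerivAt_snd (𝕜 := ℝ) (p := (z₀, u))).sub
    (HasStrictFDerivAt.comp (g := solOp p N) (z₀, u) hS h1)
  set T : CI →L[ℝ] CI := (ctail (p - 1)⁻¹ ∘L ContinuousLinearMap.mul ℝ CI d ∘L wavg N) ∘L
    (z₀.2 • ContinuousLinearMap.mul ℝ CI (nem F₂ u)) with hT
  have hcomp : IsCompactOperator T :=
    ((isCompactOperator_ctail hβ).comp_clm (ContinuousLinearMap.mul ℝ CI d ∘L wavg N)).comp_clm _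
  have hinv : IsUnit ((1 : CI →L[ℝ] CI) - T) := by
    rcases hcomp.hasEigenvalue_or_mem_resolventSet (one_ne_zero (α := ℝ)) with he | he
    · exfalso
      obtain ⟨w, hw⟩ := he.exists_hasEigenvector
      have hw1 : T w = w := by simpa using hw.apply_eq_smul
      refine hw.2 ?_
      have hw2 : ctail (p - 1)⁻¹ (d * wavg N (z₀.2 • (nem F₂ u * w))) = w := hw1
      rw [← hw2]
      refine linearized_eq_zero hp hN hh hh0 hd (q := fun r => z₀.2 * extCI (nem F₂ u) r)
        ?_ ?_ hc ?_
      · intro r hr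
        rw [hw2]
        change z₀.2 * (extCI (nem F₂ u) r * extCI w r) = _
        ring
      · intro r hr
        rw [← hu]
        exact hq (Set.projIcc 0 1 zero_le_one r)
      · intro r hr hr0
        have hr' : r ∈ Set.Icc (0:ℝ) 1 := ⟨hr0.le, hr.2.le⟩
        rw [← hu, extCI_of_mem _ hr', extCI_of_mem _ hr', extCI_of_mem _ hr']
        exact hq' ⟨r, hr'⟩ hr.1 hr.2
    · rw [spectrum.mem_resolventSet_iff, map_one] at he
      exact he
  have hinv' : ((ContinuousLinearMap.snd ℝ (ℝ × ℝ) CI -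
      (ctail (p - 1)⁻¹ ∘L ContinuousLinearMap.mul ℝ CI d ∘L wavg N) ∘L
      ((((ContinuousLinearMap.fst ℝ ℝ ℝ).smulRight (1 : CI)) ∘L
          ContinuousLinearMap.fst ℝ (ℝ × ℝ) CI) +
        (z₀.2 • (ContinuousLinearMap.mul ℝ CI (nem F₂ u) ∘L ContinuousLinearMap.snd ℝ (ℝ × ℝ) CI) +
          ((ContinuousLinearMap.snd ℝ ℝ ℝ) ∘L
            ContinuousLinearMap.fst ℝ (ℝ × ℝ) CI).smulRight (nem F u)))) ∘L
      ContinuousLinearMap.inr ℝ (ℝ × ℝ) CI).IsInvertible := by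
    obtain ⟨e, he⟩ := hinv
    refine ⟨ContinuousLinearEquiv.unitsEquiv ℝ CI e, ?_⟩
    ext1 x
    have : (e : CI →L[ℝ] CI) x = x - T x := by rw [he]; rfl
    change (e : CI →L[ℝ] CI) x = _
    rw [this, hT]
    simp
  have hz : (solOp p N (z₀.1 • 1 + z₀.2 • nem F u)) = u := hu.symm
  refine ⟨h2.implicitFunctionOfProdDomain hinv', _,
    h2.hasStrictFDerivAt_implicitFunctionOfProdDomain hinv', ?_, ?_⟩
  · exact (h2.eventually_apply_eq_iff_implicitFunctionOfProdDomain hinv').self_of_nhds.mp rfl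
  · filter_upwards [h2.eventually_apply_implicitFunctionOfProdDomain hinv'] with z hz'
    simp only [Pi.sub_apply] at hz'
    rw [hz, sub_self, sub_eq_zero] at hz'
    exact hz'

end nondegenerate

/-! ### The differential equation and the solution operator -/

section ode

variable {p : ℝ} {N : ℕ}

lemma phi_of_nonneg (hp : 2 < p) {x : ℝ} (hx : 0 ≤ x) : phi p x = x ^ (p - 1) := by
  rcases hx.eq_or_lt with rfl | hx
  · rw [phi, mul_zero, Real.zero_rpow (by linarith)]
  · rw [phi, abs_of_pos hx, ← Real.rpow_add_one hx.ne']
    congr 1; ring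

lemma phi_neg (x : ℝ) : phi p (-x) = -phi p x := by
  rw [phi, phi, abs_neg, mul_neg]

lemma eq_of_phi_eq_neg (hp : 2 < p) {x c : ℝ} (hc : 0 ≤ c) (h : phi p x = -c) :
    x = -c ^ (p - 1)⁻¹ := by
  have hp1 : p - 1 ≠ 0 := by linarith
  have hx : x ≤ 0 := by
    by_contra! hx
    have := Real.rpow_pos_of_pos hx (p - 1)
    rw [← phi_of_nonneg hp hx.le] at this
    linarith
  have h1 : (-x) ^ (p - 1) = c := by
    rw [← phi_of_nonneg hp (neg_nonneg.2 hx), phi_neg, h, neg_neg]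
  rw [← h1, Real.rpow_rpow_inv (neg_nonneg.2 hx) hp1, neg_neg]

lemma continuousOn_eq_of_Ioo {F G : ℝ → ℝ} (hF : ContinuousOn F (Set.Icc 0 1))
    (hG : ContinuousOn G (Set.Icc 0 1)) (h : Set.EqOn F G (Set.Ioo 0 1)) :
    Set.EqOn F G (Set.Icc 0 1) :=
  h.of_subset_closure hF hG Set.Ioo_subset_Icc_self (closure_Ioo (zero_ne_one (α := ℝ))).ge

lemma eq_of_hasDerivAt_eq {F G F' : ℝ → ℝ} (hF : ContinuousOn F (Set.Icc 0 1))
    (hG : ContinuousOn G (Set.Icc 0 1)) (hF' : ∀ r ∈ Set.Ioo (0:ℝ) 1, HasDerivAt F (F' r) r)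
    (hG' : ∀ r ∈ Set.Ioo (0:ℝ) 1, HasDerivAt G (F' r) r) {a : ℝ} (ha : a ∈ Set.Icc (0:ℝ) 1)
    (hFG : F a = G a) : Set.EqOn F G (Set.Icc 0 1) := by
  have hd : ∀ r ∈ Set.Ioo (0:ℝ) 1, HasDerivAt (fun r => F r - G r) 0 r := fun r hr => by
    simpa using (hF' r hr).fun_sub (hG' r hr)
  have hm : (1/2 : ℝ) ∈ Set.Ioo (0:ℝ) 1 := by norm_num
  have h1 := continuousOn_eq_of_Ioo (hF.sub hG)
    (continuousOn_const (c := F (1/2) - G (1/2))) (fun r hr => eq_of_hasDerivAt_zero hd hr hm)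
  have h2 := h1 ha
  intro r hr
  have h3 := h1 hr
  simp only [Pi.sub_apply] at h2 h3
  linarith

lemma c1on01_of_hasDerivAt {G G' : ℝ → ℝ} (hG : ContinuousOn G (Set.Icc 0 1))
    (hd : ∀ r ∈ Set.Ioo (0:ℝ) 1, HasDerivAt G (G' r) r) (hG' : ContinuousOn G' (Set.Icc 0 1)) :
    C1on01 G ∧ ∀ r ∈ Set.Icc (0:ℝ) 1, deriv01 G r = G' r := by
  have hdo : DifferentiableOn ℝ G (Set.Ioo 0 1) :=
    fun r hr => (hd r hr).differentiableAt.differentiableWithinAt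
  have key : ∀ r ∈ Set.Icc (0:ℝ) 1, HasDerivWithinAt G (G' r) (Set.Icc 0 1) r := by
    intro r hr
    rcases hr.1.eq_or_lt with rfl | h0
    · refine (hasDerivWithinAt_Ici_of_tendsto_deriv hdo
        ((hG 0 hr).mono Set.Ioo_subset_Icc_self) (Ioo_mem_nhdsGT zero_lt_one) ?_).mono
        Set.Icc_subset_Ici_self
      have h1 : Tendsto G' (𝓝[>] 0) (𝓝 (G' 0)) := by
        have := (hG' 0 hr).mono_left (nhdsWithin_mono 0 Set.Ioo_subset_Icc_self)
        rwa [nhdsWithin_Ioo_eq_nhdsGT zero_lt_one] at this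
      refine h1.congr' ?_
      filter_upwards [Ioo_mem_nhdsGT (zero_lt_one (α := ℝ))] with s hs using (hd s hs).deriv.symm
    rcases hr.2.eq_or_lt with rfl | h1
    · refine (hasDerivWithinAt_Iic_of_tendsto_deriv hdo
        ((hG 1 hr).mono Set.Ioo_subset_Icc_self) (Ioo_mem_nhdsLT zero_lt_one) ?_).mono
        Set.Icc_subset_Iic_self
      have h1 : Tendsto G' (𝓝[<] 1) (𝓝 (G' 1)) := by
        have := (hG' 1 hr).mono_left (nhdsWithin_mono 1 Set.Ioo_subset_Icc_self)
        rwa [nhdsWithin_Ioo_eq_nhdsLT zero_lt_one] at this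
      refine h1.congr' ?_
      filter_upwards [Ioo_mem_nhdsLT (zero_lt_one (α := ℝ))] with s hs using (hd s hs).deriv.symm
    · exact (hd r ⟨h0, h1⟩).hasDerivWithinAt
  have hder : ∀ r ∈ Set.Icc (0:ℝ) 1, deriv01 G r = G' r :=
    fun r hr => (key r hr).derivWithin (uniqueDiffOn_Icc zero_lt_one r hr)
  exact ⟨⟨fun r hr => (key r hr).differentiableWithinAt, hG'.congr hder⟩, hder⟩

/-- `u` solves `-(r^(N-1) φ_p(u'))' = r^(N-1) g` on `(0,1)` with `u'(0) = u(1) = 0`. -/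
def IsRadialSol (p : ℝ) (N : ℕ) (g u : ℝ → ℝ) : Prop :=
  C1on01 u ∧ C1on01 (fun r => phi p (deriv01 u r)) ∧
  (∀ r ∈ Set.Ioo (0:ℝ) 1,
      HasDerivAt (fun s => s ^ (N - 1) * phi p (deriv01 u s)) (-(r ^ (N - 1) * g r)) r) ∧
  deriv01 u 0 = 0 ∧ u 1 = 0

lemma C1on01.continuousOn {u : ℝ → ℝ} (hu : C1on01 u) : ContinuousOn u (Set.Icc 0 1) :=
  fun r hr => (hu.1 r hr).continuousWithinAt

lemma C1on01.hasDerivAt {u : ℝ → ℝ} (hu : C1on01 u) {r : ℝ} (hr : r ∈ Set.Ioo (0:ℝ) 1) :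
    HasDerivAt u (deriv01 u r) r :=
  (hu.1 r (Set.Ioo_subset_Icc_self hr)).hasDerivWithinAt.hasDerivAt (Icc_mem_nhds hr.1 hr.2)

theorem IsRadialSol.eqOn_solOp (hp : 2 < p) (hN : 1 ≤ N) {g u : ℝ → ℝ} (hu : IsRadialSol p N g u)
    {h : CI} (hh : ∀ r, 0 ≤ h r) (hg : ∀ r ∈ Set.Ioo (0:ℝ) 1, g r = extCI h r) :
    Set.EqOn u (extCI (solOp p N h)) (Set.Icc 0 1) := by
  obtain ⟨h1, h2, h3, h4, h5⟩ := hu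
  have e1 : Set.EqOn (fun s => s ^ (N - 1) * phi p (deriv01 u s))
      (fun s => -(s ^ N * extCI (wavg N h) s)) (Set.Icc 0 1) := by
    refine eq_of_hasDerivAt_eq ?_ ?_ h3 ?_ (a := 0) ⟨le_rfl, zero_le_one⟩ ?_
    · exact (continuous_pow _).continuousOn.mul h2.continuousOn
    · exact (((continuous_pow _).mul (continuous_extCI _)).neg).continuousOn
    · intro r hr
      rw [hg r hr]
      exact (hasDerivAt_pow_mul_wavg hN h hr).fun_neg
    · rw [h4, phi, mul_zero, mul_zero, zero_pow (by omega : N ≠ 0), zero_mul, neg_zero]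
  refine eq_of_hasDerivAt_eq h1.continuousOn (continuous_extCI _).continuousOn
    (fun r hr => h1.hasDerivAt hr) ?_ (a := 1) ⟨zero_le_one, le_rfl⟩ ?_
  · intro r hr
    have h6 : phi p (deriv01 u r) = -(r * extCI (wavg N h) r) := by
      have h7 := e1 (Set.Ioo_subset_Icc_self hr)
      obtain ⟨n, rfl⟩ : ∃ n, N = n + 1 := ⟨N - 1, by omega⟩
      simp only [Nat.add_sub_cancel] at h7
      refine mul_left_cancel₀ (pow_pos hr.1 n).ne' ?_
      rw [h7]; ring
    have hM : 0 ≤ extCI (wavg N h) r := wavg_nonneg N hh _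
    have h8 := eq_of_phi_eq_neg hp (mul_nonneg hr.1.le hM) h6
    rw [h8, Real.mul_rpow hr.1.le hM]
    have h9 := hasDerivAt_solOp (N := N) hp h hr
    rwa [show extCI (radSlope p N h) r = extCI (wavg N h) r ^ (p - 1)⁻¹ from
      radSlope_apply hp h _] at h9
  · rw [h5, solOp_one hp]

theorem isRadialSol_solOp (hp : 2 < p) (hN : 1 ≤ N) {h : CI} (hh : ∀ r, 0 ≤ h r) :
    IsRadialSol p N (extCI h) (extCI (solOp p N h)) := by
  have hβ := inv_sub_one_nonneg hp
  have hβ0 : (p - 1)⁻¹ ≠ 0 := inv_ne_zero (by linarith)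
  obtain ⟨c1, c2⟩ := c1on01_of_hasDerivAt (continuous_extCI (solOp p N h)).continuousOn
    (fun r hr => hasDerivAt_solOp (N := N) hp h hr)
    (continuous_rpow_mul_extCI hβ _).neg.continuousOn
  have hphi : ∀ r ∈ Set.Icc (0:ℝ) 1,
      phi p (deriv01 (extCI (solOp p N h)) r) = -(r * extCI (wavg N h) r) := by
    intro r hr
    have hy : 0 ≤ extCI (radSlope p N h) r := radSlope_nonneg hp hh _
    rw [c2 r hr, phi_neg, phi_of_nonneg hp (mul_nonneg (Real.rpow_nonneg hr.1 _) hy),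
      Real.mul_rpow (Real.rpow_nonneg hr.1 _) hy, extCI_radSlope_rpow hp hh,
      Real.rpow_inv_rpow hr.1 (by linarith)]
  have hpow : ∀ r ∈ Set.Ioo (0:ℝ) 1, HasDerivAt (fun s => s * extCI (wavg N h) s)
      ((1 - N) * extCI (wavg N h) r + extCI h r) r := by
    intro r hr
    have h1 := (hasDerivAt_pow_mul_wavg hN h hr).fun_div (hasDerivAt_pow (N - 1) r)
      (pow_pos hr.1 (N - 1)).ne'
    have hr0 := hr.1
    obtain ⟨n, rfl⟩ : ∃ n, N = n + 1 := ⟨N - 1, by omega⟩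
    simp only [Nat.add_sub_cancel] at h1
    refine (h1.congr_of_eventuallyEq ?_).congr_deriv ?_
    · filter_upwards [Ioo_mem_nhds hr.1 hr.2] with s hs
      have := hs.1
      field_simp
      ring
    · rcases n with _ | n
      · simp
      · simp only [Nat.add_sub_cancel]
        push_cast
        field_simp
        ring
  have c3 : C1on01 fun r => phi p (deriv01 (extCI (solOp p N h)) r) := by
    refine (c1on01_of_hasDerivAt (G' := fun r => -((1 - N) * extCI (wavg N h) r + extCI h r))
      ?_ ?_ ?_).1
    · exact ((continuous_id.mul (continuous_extCI _)).neg.continuousOn).congr hphi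
    · intro r hr
      refine (hpow r hr).fun_neg.congr_of_eventuallyEq ?_
      filter_upwards [Ioo_mem_nhds hr.1 hr.2] with s hs using hphi s (Set.Ioo_subset_Icc_self hs)
    · have := continuous_extCI (wavg N h)
      have := continuous_extCI h
      fun_prop
  refine ⟨c1, c3, ?_, ?_, solOp_one hp h⟩
  · intro r hr
    refine (hasDerivAt_pow_mul_wavg hN h hr).fun_neg.congr_of_eventuallyEq ?_
    filter_upwards [Ioo_mem_nhds hr.1 hr.2] with s hs
    rw [hphi s (Set.Ioo_subset_Icc_self hs)]
    obtain ⟨n, rfl⟩ : ∃ n, N = n + 1 := ⟨N - 1, by omega⟩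
    simp only [Nat.add_sub_cancel]
    ring
  · rw [c2 0 ⟨le_rfl, zero_le_one⟩, Real.zero_rpow hβ0, zero_mul, neg_zero]

end ode

/-! ### Positive solutions of a two-parameter nonlinear problem -/

section posSol

variable {p : ℝ} {N : ℕ}

/-- The superposition operator `u ↦ μ + lam F(r, u)` with `z = (μ, lam)`. -/
def source (F : C(Set.Icc (0:ℝ) 1 × ℝ, ℝ)) (z : ℝ × ℝ) (u : CI) : CI :=
  z.1 • 1 + z.2 • nem F u

/-- `u` is a positive solution of `-(r^(N-1) φ_p(u'))' = r^(N-1) (μ + lam F(r, u))`,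
`u'(0) = u(1) = 0`, where `z = (μ, lam)`. -/
def PosSol (p : ℝ) (N : ℕ) (F : C(Set.Icc (0:ℝ) 1 × ℝ, ℝ)) (z : ℝ × ℝ) (u : CI) : Prop :=
  u = solOp p N (source F z u) ∧ 0 < extCI u 0

/-- The homogeneous nonlinearity `w(r) |x|^(p-1)`. -/
def homFun (p : ℝ) (w : CI) : C(Set.Icc (0:ℝ) 1 × ℝ, ℝ) :=
  (w.comp ⟨Prod.fst, continuous_fst⟩) * (powFun (p - 1)).comp
    ⟨fun z => (z.1, |z.2|), by fun_prop⟩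

variable {F G : C(Set.Icc (0:ℝ) 1 × ℝ, ℝ)} {z y : ℝ × ℝ} {u v : CI}

lemma homFun_apply (hp : 2 < p) (w : CI) (r : Set.Icc (0:ℝ) 1) (x : ℝ) :
    homFun p w (r, x) = w r * |x| ^ (p - 1) := by
  have : powFun (p - 1) (r, |x|) = |x| ^ (p - 1) := powFun_apply (by linarith) _
  rw [← this]
  rfl

lemma source_apply (r : Set.Icc (0:ℝ) 1) : source F z u r = z.1 + z.2 * F (r, u r) := by
  simp [source, nem_apply]

lemma solOp_zero (hp : 2 < p) : solOp p N 0 = 0 := by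
  have h := solOp_smul (N := N) hp (h := 0) (fun r => le_rfl) (le_refl (0:ℝ))
  rwa [smul_zero, zero_smul] at h

lemma continuous_source : Continuous fun q : (ℝ × ℝ) × CI => source F q.1 q.2 := by
  have := (continuous_nem F).comp (continuous_snd (X := ℝ × ℝ))
  unfold source
  fun_prop

lemma source_nonneg (hF : ∀ q, 0 ≤ F q) (hz : 0 ≤ z) (r : Set.Icc (0:ℝ) 1) :
    0 ≤ source F z u r := by
  rw [source_apply]
  exact add_nonneg hz.1 (mul_nonneg hz.2 (hF _))

lemma PosSol.nonneg (hp : 2 < p) (hF : ∀ q, 0 ≤ F q) (hz : 0 ≤ z) (hu : PosSol p N F z u)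
    (r : Set.Icc (0:ℝ) 1) : 0 ≤ u r := by
  rw [hu.1]
  exact solOp_nonneg hp (source_nonneg hF hz) r

lemma PosSol.norm_eq (hp : 2 < p) (hF : ∀ q, 0 ≤ F q) (hz : 0 ≤ z) (hu : PosSol p N F z u) :
    ‖u‖ = extCI u 0 := by
  rw [hu.1]
  exact norm_solOp hp (source_nonneg hF hz)

lemma PosSol.source_pos (hp : 2 < p) (hF' : ∀ r x, 0 < x → 0 < F (r, x))
    (hz : 0 ≤ z) (hu : PosSol p N F z u) : 0 < extCI (source F z u) 0 := by
  have h0 : (0:ℝ) ∈ Set.Icc (0:ℝ) 1 := ⟨le_rfl, zero_le_one⟩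
  rw [extCI_of_mem _ h0, source_apply]
  have hpos := hF' ⟨0, h0⟩ _ (extCI_of_mem u h0 ▸ hu.2)
  have hz1 : 0 ≤ z.1 := hz.1
  have hz2 : 0 ≤ z.2 := hz.2
  rcases hz1.eq_or_lt with h1 | h1
  · rcases hz2.eq_or_lt with h2 | h2
    · have h3 : u = 0 := by
        rw [hu.1, source, ← h1, ← h2, zero_smul, zero_smul, add_zero, solOp_zero hp]
      have h4 := hu.2
      rw [h3] at h4
      exact absurd h4 (lt_irrefl _)
    · positivity
  · positivity

lemma PosSol.pos (hp : 2 < p) (hF : ∀ q, 0 ≤ F q) (hF' : ∀ r x, 0 < x → 0 < F (r, x))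
    (hz : 0 ≤ z) (hu : PosSol p N F z u) {r : ℝ} (hr : r ∈ Set.Ico (0:ℝ) 1) : 0 < extCI u r := by
  have h := solOp_pos (N := N) hp (source_nonneg hF hz) (hu.source_pos hp hF' hz) hr
  rwa [← hu.1] at h

lemma PosSol.one (hp : 2 < p) (hu : PosSol p N F z u) : extCI u 1 = 0 := by
  rw [hu.1]
  exact solOp_one hp _

lemma PosSol.exists_lt_near_one (hp : 2 < p) (hu : PosSol p N F z u) {e : ℝ} (he : 0 < e) :
    ∃ c < 1, ∀ r, c < r → extCI u r < e := by
  have h1 : Tendsto (extCI u) (𝓝 1) (𝓝 0) := by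
    have := (continuous_extCI u).tendsto 1
    rwa [hu.one hp] at this
  obtain ⟨c, hc, h2⟩ := exists_Ioc_subset_of_mem_nhds (h1.eventually (gt_mem_nhds he))
    ⟨0, zero_lt_one⟩
  refine ⟨c, hc, fun r hr => ?_⟩
  rcases le_or_gt r 1 with h | h
  · exact h2 ⟨hr, h⟩
  · have h3 : extCI u r = extCI u 1 := by
      rw [extCI, Set.IccExtend_of_right_le _ _ h.le, Set.IccExtend_of_right_le _ _ le_rfl]
    rw [h3, hu.one hp]
    exact he

/-- Comparison of the weights `(μ + lam F(r, u)) / u^(p-1)` of two positive solutions. -/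
theorem PosSol.weight_eq (hp : 2 < p) (hN : 1 ≤ N) (hF : ∀ q, 0 ≤ F q)
    (hF' : ∀ r x, 0 < x → 0 < F (r, x)) (hG : ∀ q, 0 ≤ G q) (hG' : ∀ r x, 0 < x → 0 < G (r, x))
    (hz : 0 ≤ z) (hy : 0 ≤ y) (hu : PosSol p N F z u) (hv : PosSol p N G y v)
    (hle : ∀ r : Set.Icc (0:ℝ) 1, (r : ℝ) ∈ Set.Ioo (0:ℝ) 1 → 0 < u r → 0 < v r →
      source F z u r / u r ^ (p - 1) ≤ source G y v r / v r ^ (p - 1)) :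
    ∀ r : Set.Icc (0:ℝ) 1, (r : ℝ) ∈ Set.Ioo (0:ℝ) 1 →
      source F z u r / u r ^ (p - 1) = source G y v r / v r ^ (p - 1) := by
  have hup : ∀ r ∈ Set.Ioo (0:ℝ) 1, 0 < extCI u r :=
    fun r hr => hu.pos hp hF hF' hz ⟨hr.1.le, hr.2⟩
  have hvp : ∀ r ∈ Set.Ioo (0:ℝ) 1, 0 < extCI v r :=
    fun r hr => hv.pos hp hG hG' hy ⟨hr.1.le, hr.2⟩
  have h := weight_eq_of_le (N := N) hp hN (source_nonneg hF hz) (hu.source_pos hp hF' hz)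
    (source_nonneg hG hy) (hv.source_pos hp hG' hy)
    (a := fun r => extCI (source F z u) r / extCI u r ^ (p - 1))
    (b := fun r => extCI (source G y v) r / extCI v r ^ (p - 1)) ?_ ?_ ?_
  · intro r hr
    have := h r hr
    simpa only [extCI_coe] using this
  · intro r hr
    rw [← hu.1, div_mul_cancel₀ _ (Real.rpow_pos_of_pos (hup r hr) _).ne']
  · intro r hr
    rw [← hv.1, div_mul_cancel₀ _ (Real.rpow_pos_of_pos (hvp r hr) _).ne']
  · intro r hr
    have hr' := Set.Ioo_subset_Icc_self hr
    have h1 := hup r hr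
    have h2 := hvp r hr
    simp only [extCI_of_mem _ hr'] at h1 h2 ⊢
    exact hle ⟨r, hr'⟩ hr h1 h2

/-- Solutions with bounded sources are precompact. -/
lemma exists_subseq_solOp (hp : 2 < p) {h : ℕ → CI} {C : ℝ} (hb : ∀ n, ‖h n‖ ≤ C) :
    ∃ u, ∃ φ : ℕ → ℕ, StrictMono φ ∧ Tendsto (fun n => solOp p N (h (φ n))) atTop (𝓝 u) := by
  have hβ := inv_sub_one_nonneg hp
  have hC : 0 ≤ C := (norm_nonneg _).trans (hb 0)
  set D := ‖wavg N‖ * C with hD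
  have hD0 : 0 ≤ D := mul_nonneg (norm_nonneg (wavg N)) hC
  have hw : ∀ n, ‖wavg N (h n)‖ ≤ D := fun n =>
    ((wavg N).le_opNorm _).trans (mul_le_mul_of_nonneg_left (hb n) (norm_nonneg _))
  have hr : ∀ n, radSlope p N (h n) ∈ Metric.closedBall (0 : CI) (D ^ (p - 1)⁻¹) := by
    intro n
    rw [mem_closedBall_zero_iff, ContinuousMap.norm_le _ (Real.rpow_nonneg hD0 _)]
    intro r
    rw [radSlope_apply hp, Real.norm_eq_abs]
    refine (Real.abs_rpow_le_abs_rpow _ _).trans (Real.rpow_le_rpow (abs_nonneg _) ?_ hβ)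
    exact ((wavg N (h n)).norm_coe_le_norm r).trans (hw n)
  obtain ⟨K, hK, hKs⟩ := (isCompactOperator_ctail hβ).image_closedBall_subset_compact
    (D ^ (p - 1)⁻¹)
  obtain ⟨u, -, φ, hφ, ht⟩ := hK.tendsto_subseq (x := fun n => solOp p N (h n))
    (fun n => hKs ⟨_, hr n, rfl⟩)
  exact ⟨u, φ, hφ, ht⟩

lemma norm_nem_le (F : C(Set.Icc (0:ℝ) 1 × ℝ, ℝ)) (R : ℝ) :
    ∃ C, ∀ u : CI, ‖u‖ ≤ R → ‖nem F u‖ ≤ C := by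
  have hK : IsCompact ((Set.univ : Set (Set.Icc (0:ℝ) 1)) ×ˢ Set.Icc (-R) R) :=
    isCompact_univ.prod isCompact_Icc
  obtain ⟨C, hC⟩ := hK.exists_bound_of_continuousOn F.continuous.continuousOn
  refine ⟨max C 0, fun u hu => (ContinuousMap.norm_le _ (le_max_right _ _)).2 fun r => ?_⟩
  refine (hC (r, u r) ⟨Set.mem_univ _, ?_⟩).trans (le_max_left _ _)
  exact abs_le.1 ((u.norm_coe_le_norm r).trans hu)

lemma exists_norm_bound_seq {z : ℕ → ℝ × ℝ} {z₀ : ℝ × ℝ} (hz : Tendsto z atTop (𝓝 z₀)) :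
    ∃ C, 0 ≤ C ∧ ∀ n, ‖z n‖ ≤ C := by
  obtain ⟨C, hC⟩ := (Metric.isBounded_range_of_tendsto z hz).exists_norm_le
  exact ⟨C, (norm_nonneg _).trans (hC _ ⟨0, rfl⟩), fun n => hC _ ⟨n, rfl⟩⟩

/-- Limits of positive solutions that are bounded and bounded away from zero. -/
theorem exists_posSol_of_tendsto (hp : 2 < p) (hF : ∀ q, 0 ≤ F q) {z : ℕ → ℝ × ℝ}
    {z₀ : ℝ × ℝ} (hz : Tendsto z atTop (𝓝 z₀)) (hz0 : ∀ n, 0 ≤ z n) {u : ℕ → CI}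
    (hu : ∀ n, PosSol p N F (z n) (u n)) {d R : ℝ} (hd : 0 < d) (hdu : ∀ n, d ≤ ‖u n‖)
    (hR : ∀ n, ‖u n‖ ≤ R) : ∃ u₀, PosSol p N F z₀ u₀ := by
  obtain ⟨C, hC⟩ := norm_nem_le F R
  obtain ⟨Z, hZ0, hZ⟩ := exists_norm_bound_seq hz
  have hb : ∀ n, ‖source F (z n) (u n)‖ ≤ Z * ‖(1 : CI)‖ + Z * C := by
    intro n
    refine (norm_add_le _ _).trans (add_le_add ?_ ?_)
    · rw [norm_smul]
      exact mul_le_mul_of_nonneg_right ((norm_fst_le _).trans (hZ n)) (norm_nonneg _)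
    · rw [norm_smul]
      exact mul_le_mul ((norm_snd_le _).trans (hZ n)) (hC _ (hR n)) (norm_nonneg _) hZ0
  obtain ⟨u₀, φ, hφ, ht⟩ := exists_subseq_solOp (N := N) hp hb
  have ht' : Tendsto (fun n => u (φ n)) atTop (𝓝 u₀) :=
    ht.congr fun n => ((hu (φ n)).1).symm
  refine ⟨u₀, ?_, ?_⟩
  · have h1 := (continuous_solOp (p := p) (N := N)).comp (continuous_source (F := F))
    have h2 := (h1.tendsto (z₀, u₀)).comp ((hz.comp hφ.tendsto_atTop).prodMk_nhds ht')
    exact tendsto_nhds_unique ht h2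
  · have h3 : Tendsto (fun n => extCI (u (φ n)) 0) atTop (𝓝 (extCI u₀ 0)) :=
      ((continuous_eval_const (F := CI) (Set.projIcc (0:ℝ) 1 zero_le_one 0)).tendsto
        u₀).comp ht'
    refine hd.trans_le (ge_of_tendsto' h3 fun n => ?_)
    rw [← (hu (φ n)).norm_eq hp hF (hz0 _)]
    exact hdu _

end posSol

/-! ### Sublinear-type nonlinearities -/

section nonlin

/-- The structural hypotheses on the nonlinearity `F` with partial derivative `F₂`: positivity,
`F(r, x) / x^(p-1)` is nonincreasing in `x > 0`, strictly near `(1, 0)`, with uniform limits `w₀`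
at zero and `wi` at infinity. -/
structure Nonlin (p : ℝ) (F F₂ : C(Set.Icc (0:ℝ) 1 × ℝ, ℝ)) (w₀ wi : CI) : Prop where
  hp : 2 < p
  hasDerivAt : ∀ r x, HasDerivAt (fun t => F (r, t)) (F₂ (r, x)) x
  pos : ∀ r x, x ≠ 0 → 0 < F (r, x)
  zero : ∀ r, F (r, 0) = 0
  deriv_le : ∀ r x, 0 ≤ x → F₂ (r, x) * x ≤ (p - 1) * F (r, x)
  deriv_lt : ∃ c : ℝ, c < 1 ∧ ∃ ε : ℝ, 0 < ε ∧ ∀ r : Set.Icc (0:ℝ) 1, c < r → ∀ x ∈ Set.Ioo (0:ℝ) ε,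
    F₂ (r, x) * x < (p - 1) * F (r, x)
  lim_zero : ∀ e > 0, ∃ d > 0, ∀ x ∈ Set.Ioo (0:ℝ) d, ∀ r, |F (r, x) / x ^ (p - 1) - w₀ r| < e
  lim_infty : ∀ e > 0, ∃ M, ∀ x, 0 < x → M ≤ x → ∀ r, |F (r, x) / x ^ (p - 1) - wi r| < e

variable {p : ℝ} {N : ℕ} {F F₂ : C(Set.Icc (0:ℝ) 1 × ℝ, ℝ)} {w₀ wi w : CI} {z : ℝ × ℝ}
  {u v : CI} {lam κ : ℝ}

lemma homFun_nonneg (hp : 2 < p) (hw : ∀ r, 0 ≤ w r) (q) : 0 ≤ homFun p w q := by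
  obtain ⟨r, x⟩ := q
  rw [homFun_apply hp]
  exact mul_nonneg (hw r) (Real.rpow_nonneg (abs_nonneg _) _)

lemma homFun_pos (hp : 2 < p) (hw : ∀ r, 0 < w r) (r) (x : ℝ) (hx : 0 < x) :
    0 < homFun p w (r, x) := by
  rw [homFun_apply hp]
  exact mul_pos (hw r) (Real.rpow_pos_of_pos (abs_pos.2 hx.ne') _)

lemma source_div (r : Set.Icc (0:ℝ) 1) :
    source F (0, lam) u r / u r ^ (p - 1) = lam * (F (r, u r) / u r ^ (p - 1)) := by
  rw [source_apply, zero_add, mul_div_assoc]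

lemma source_homFun_div (hp : 2 < p) {r : Set.Icc (0:ℝ) 1} (hv : 0 < v r) :
    source (homFun p w) (0, lam) v r / v r ^ (p - 1) = lam * w r := by
  rw [source_div, homFun_apply hp, abs_of_pos hv,
    mul_div_cancel_right₀ _ (Real.rpow_pos_of_pos hv _).ne']

lemma PosSol.ne_zero (hu : PosSol p N F z u) : u ≠ 0 := by
  rintro rfl
  exact absurd hu.2 (lt_irrefl _)

lemma PosSol.lam_pos (hp : 2 < p) (hu : PosSol p N F (0, lam) u) (h : 0 ≤ lam) : 0 < lam := by
  refine h.lt_of_ne fun h0 => hu.ne_zero ?_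
  rw [hu.1, source, ← h0, zero_smul, zero_smul, add_zero, solOp_zero hp]

lemma zero_le_pair (h : 0 ≤ lam) : (0 : ℝ × ℝ) ≤ (0, lam) := ⟨le_rfl, h⟩

lemma exists_Icc_between {c : ℝ} (hc : c < 1) :
    ∃ r : Set.Icc (0:ℝ) 1, c < (r : ℝ) ∧ (r : ℝ) ∈ Set.Ioo (0:ℝ) 1 := by
  obtain ⟨s, h1, h2⟩ := exists_between (max_lt zero_lt_one hc : max 0 c < 1)
  have h3 : 0 < s := (le_max_left _ _).trans_lt h1
  exact ⟨⟨s, h3.le, h2.le⟩, (le_max_right _ _).trans_lt h1, h3, h2⟩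

namespace Nonlin

variable (H : Nonlin p F F₂ w₀ wi)
include H

lemma nonneg (q) : 0 ≤ F q := by
  obtain ⟨r, x⟩ := q
  rcases eq_or_ne x 0 with rfl | hx
  · exact (H.zero r).ge
  · exact (H.pos r x hx).le

lemma pos' (r) (x : ℝ) (hx : 0 < x) : 0 < F (r, x) := H.pos r x hx.ne'

lemma hasDerivAt_ratio (r) {x : ℝ} (hx : 0 < x) :
    HasDerivAt (fun x => F (r, x) / x ^ (p - 1))
      ((F₂ (r, x) * x - (p - 1) * F (r, x)) * (x ^ (p - 1) / x) / (x ^ (p - 1)) ^ 2) x := by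
  have h1 := Real.rpow_pos_of_pos hx (p - 1)
  refine ((H.hasDerivAt r x).fun_div (Real.hasDerivAt_rpow_const (Or.inl hx.ne')) h1.ne').congr_deriv
    ?_
  rw [Real.rpow_sub_one hx.ne' (p - 1)]
  field_simp

lemma ratio_antitone (r) : AntitoneOn (fun x => F (r, x) / x ^ (p - 1)) (Set.Ioi 0) := by
  refine antitoneOn_of_deriv_nonpos (convex_Ioi 0)
    (fun x hx => (H.hasDerivAt_ratio r hx).continuousAt.continuousWithinAt) ?_ ?_
  · rw [interior_Ioi]
    exact fun x hx => (H.hasDerivAt_ratio r hx).differentiableAt.differentiableWithinAt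
  · rw [interior_Ioi]
    intro x hx
    rw [(H.hasDerivAt_ratio r hx).deriv]
    have h1 := Real.rpow_pos_of_pos hx (p - 1)
    exact div_nonpos_of_nonpos_of_nonneg (mul_nonpos_of_nonpos_of_nonneg
      (sub_nonpos.2 (H.deriv_le r x (le_of_lt hx))) (div_nonneg h1.le (le_of_lt hx))) (sq_nonneg _)

lemma exists_strictAnti : ∃ c : ℝ, c < 1 ∧ ∃ ε : ℝ, 0 < ε ∧ ∀ r : Set.Icc (0:ℝ) 1, c < r →
    StrictAntiOn (fun x => F (r, x) / x ^ (p - 1)) (Set.Ioo 0 ε) := by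
  obtain ⟨c, hc, ε, hε, h⟩ := H.deriv_lt
  refine ⟨c, hc, ε, hε, fun r hr => strictAntiOn_of_deriv_neg (convex_Ioo 0 ε)
    (fun x hx => (H.hasDerivAt_ratio r hx.1).continuousAt.continuousWithinAt) ?_⟩
  rw [interior_Ioo]
  intro x hx
  rw [(H.hasDerivAt_ratio r hx.1).deriv]
  have h1 := Real.rpow_pos_of_pos hx.1 (p - 1)
  exact div_neg_of_neg_of_pos (mul_neg_of_neg_of_pos
    (sub_neg.2 (h r hr x hx)) (div_pos h1 hx.1)) (pow_pos h1 2)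

lemma ratio_le (r) {x : ℝ} (hx : 0 < x) : F (r, x) / x ^ (p - 1) ≤ w₀ r := by
  refine le_of_forall_pos_le_add fun e he => ?_
  obtain ⟨d, hd, h⟩ := H.lim_zero e he
  have h1 : 0 < min x (d / 2) := lt_min hx (by linarith)
  have h2 := H.ratio_antitone r h1 hx (min_le_left _ _)
  have h3 := (abs_lt.1 (h (min x (d / 2)) ⟨h1, (min_le_right _ _).trans_lt (by linarith)⟩ r)).2
  simp only at h2
  linarith

lemma le_ratio (r) {x : ℝ} (hx : 0 < x) : wi r ≤ F (r, x) / x ^ (p - 1) := by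
  refine le_of_forall_pos_le_add fun e he => ?_
  obtain ⟨M, h⟩ := H.lim_infty e he
  have h1 : 0 < max x M := hx.trans_le (le_max_left _ _)
  have h2 := H.ratio_antitone r hx h1 (le_max_left _ _)
  have h3 := (abs_lt.1 (h (max x M) h1 (le_max_right _ _) r)).1
  simp only at h2
  linarith

lemma w₀_pos (r) : 0 < w₀ r :=
  (div_pos (H.pos' r 1 one_pos) (Real.rpow_pos_of_pos one_pos _)).trans_le (H.ratio_le r one_pos)

lemma exists_ratio_strict : ∃ c : ℝ, c < 1 ∧ ∃ ε : ℝ, 0 < ε ∧ ∀ r : Set.Icc (0:ℝ) 1, c < r →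
    ∀ x ∈ Set.Ioo 0 ε, wi r < F (r, x) / x ^ (p - 1) ∧ F (r, x) / x ^ (p - 1) < w₀ r := by
  obtain ⟨c, hc, ε, hε, h⟩ := H.exists_strictAnti
  refine ⟨c, hc, ε, hε, fun r hr x hx => ⟨?_, ?_⟩⟩
  · have h1 : x < (x + ε) / 2 := by linarith [hx.2]
    have h2 : (x + ε) / 2 < ε := by linarith [hx.2]
    exact (H.le_ratio r (hx.1.trans h1)).trans_lt (h r hr hx ⟨hx.1.trans h1, h2⟩ h1)
  · have h1 : x / 2 < x := by linarith [hx.1]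
    have h2 : 0 < x / 2 := by linarith [hx.1]
    exact (h r hr ⟨h2, h1.trans hx.2⟩ hx h1).trans_le (H.ratio_le r h2)

lemma homFun₀_nonneg (q) : 0 ≤ homFun p w₀ q := homFun_nonneg H.hp (fun r => (H.w₀_pos r).le) q

lemma homFun₀_pos (r) (x : ℝ) (hx : 0 < x) : 0 < homFun p w₀ (r, x) := homFun_pos H.hp H.w₀_pos r x hx

/-- Near `r = 1` the ratio of a positive solution lies strictly between the limit weights. -/
lemma exists_strict_ratio (hz : 0 ≤ z) (hu : PosSol p N F z u) :
    ∃ r : Set.Icc (0:ℝ) 1, (r : ℝ) ∈ Set.Ioo (0:ℝ) 1 ∧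
      wi r < F (r, u r) / u r ^ (p - 1) ∧ F (r, u r) / u r ^ (p - 1) < w₀ r := by
  obtain ⟨c, hc, ε, hε, h⟩ := H.exists_ratio_strict
  obtain ⟨c', hc', h'⟩ := hu.exists_lt_near_one H.hp hε
  obtain ⟨r, hr, hr'⟩ := exists_Icc_between (max_lt hc hc')
  refine ⟨r, hr', h r ((le_max_left _ _).trans_lt hr) (u r) ⟨?_, ?_⟩⟩
  · rw [← extCI_coe]
    exact hu.pos H.hp H.nonneg H.pos' hz ⟨hr'.1.le, hr'.2⟩
  · rw [← extCI_coe]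
    exact h' r ((le_max_right _ _).trans_lt hr)

/-- Positive solutions exist only above the principal eigenvalue of the weight at zero. -/
theorem lt_of_posSol (hN : 1 ≤ N) (hκ : 0 ≤ κ) (hv : PosSol p N (homFun p w₀) (0, κ) v)
    (hlam : 0 ≤ lam) (hu : PosSol p N F (0, lam) u) : κ < lam := by
  by_contra! hle
  obtain ⟨r, hr, -, h2⟩ := H.exists_strict_ratio (zero_le_pair hlam) hu
  have hvr : 0 < v r := by
    rw [← extCI_coe]
    exact hv.pos H.hp H.homFun₀_nonneg H.homFun₀_pos (zero_le_pair hκ) ⟨hr.1.le, hr.2⟩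
  have h := hu.weight_eq H.hp hN H.nonneg H.pos' H.homFun₀_nonneg H.homFun₀_pos
    (zero_le_pair hlam) (zero_le_pair hκ) hv (fun r _ hur hvr => ?_) r hr
  · rw [source_homFun_div H.hp hvr, source_div] at h
    have h3 := mul_lt_mul_of_pos_left h2 (hu.lam_pos H.hp hlam)
    have h4 := mul_le_mul_of_nonneg_right hle (H.w₀_pos r).le
    linarith
  · rw [source_homFun_div H.hp hvr, source_div]
    exact mul_le_mul hle (H.ratio_le r hur) (div_nonneg (H.nonneg _) (Real.rpow_nonneg hur.le _)) hκ

/-- Positive solutions exist only below the principal eigenvalue of the weight at infinity. -/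
theorem posSol_lt (hN : 1 ≤ N) (hwi : ∀ r, 0 < wi r) (hκ : 0 ≤ κ)
    (hv : PosSol p N (homFun p wi) (0, κ) v)
    (hlam : 0 ≤ lam) (hu : PosSol p N F (0, lam) u) : lam < κ := by
  by_contra! hle
  obtain ⟨r, hr, h2, -⟩ := H.exists_strict_ratio (zero_le_pair hlam) hu
  have hn := homFun_nonneg H.hp fun r => (hwi r).le
  have hp' := homFun_pos H.hp hwi
  have hvr : 0 < v r := by
    rw [← extCI_coe]
    exact hv.pos H.hp hn hp' (zero_le_pair hκ) ⟨hr.1.le, hr.2⟩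
  have h := hv.weight_eq H.hp hN hn hp' H.nonneg H.pos'
    (zero_le_pair hκ) (zero_le_pair hlam) hu (fun r _ hvr hur => ?_) r hr
  · rw [source_homFun_div H.hp hvr, source_div] at h
    have h3 := mul_lt_mul_of_pos_left h2 (hu.lam_pos H.hp hlam)
    have h4 := mul_le_mul_of_nonneg_right hle (hwi r).le
    linarith
  · rw [source_homFun_div H.hp hvr, source_div]
    exact mul_le_mul hle (H.le_ratio r hur) (hwi r).le hlam

/-- The principal eigenvalues of the limit weights are ordered. -/
theorem eigenvalue_lt (hN : 1 ≤ N) (hwi : ∀ r, 0 < wi r) (hκ : 0 ≤ κ)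
    (hv : PosSol p N (homFun p wi) (0, κ) v)
    (hlam : 0 ≤ lam) (hu : PosSol p N (homFun p w₀) (0, lam) u) : lam < κ := by
  by_contra! hle
  obtain ⟨c, hc, ε, hε, h⟩ := H.exists_ratio_strict
  obtain ⟨r, hr, hr'⟩ := exists_Icc_between hc
  have h2 := (h r hr (ε / 2) ⟨by linarith, by linarith⟩)
  have h2 : wi r < w₀ r := h2.1.trans h2.2
  have hn := homFun_nonneg H.hp fun r => (hwi r).le
  have hp' := homFun_pos H.hp hwi
  have hvr : 0 < v r := by
    rw [← extCI_coe]
    exact hv.pos H.hp hn hp' (zero_le_pair hκ) ⟨hr'.1.le, hr'.2⟩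
  have hur : 0 < u r := by
    rw [← extCI_coe]
    exact hu.pos H.hp H.homFun₀_nonneg H.homFun₀_pos (zero_le_pair hlam) ⟨hr'.1.le, hr'.2⟩
  have h := hv.weight_eq H.hp hN hn hp' H.homFun₀_nonneg H.homFun₀_pos
    (zero_le_pair hκ) (zero_le_pair hlam) hu (fun r _ hvr hur => ?_) r hr'
  · rw [source_homFun_div H.hp hvr, source_homFun_div H.hp hur] at h
    have h3 := mul_lt_mul_of_pos_left h2 (hu.lam_pos H.hp hlam)
    have h4 := mul_le_mul_of_nonneg_right hle (hwi r).le
    linarith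
  · rw [source_homFun_div H.hp hvr, source_homFun_div H.hp hur]
    exact mul_le_mul hle ((H.le_ratio r one_pos).trans (H.ratio_le r one_pos)) (hwi r).le hlam

/-- Uniqueness of positive solutions. -/
theorem posSol_unique (hN : 1 ≤ N) (hlam : 0 ≤ lam) (hu : PosSol p N F (0, lam) u)
    (hv : PosSol p N F (0, lam) v) : u = v := by
  have hlp := hu.lam_pos H.hp hlam
  obtain ⟨c, hc, ε, hε, h⟩ := H.exists_strictAnti
  obtain ⟨c₁, hc₁, h₁⟩ := hu.exists_lt_near_one H.hp hε
  obtain ⟨c₂, hc₂, h₂⟩ := hv.exists_lt_near_one H.hp hε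
  have hz := zero_le_pair hlam
  have hup : ∀ r ∈ Set.Ioo (0:ℝ) 1, 0 < extCI u r :=
    fun r hr => hu.pos H.hp H.nonneg H.pos' hz ⟨hr.1.le, hr.2⟩
  have hvp : ∀ r ∈ Set.Ioo (0:ℝ) 1, 0 < extCI v r :=
    fun r hr => hv.pos H.hp H.nonneg H.pos' hz ⟨hr.1.le, hr.2⟩
  have key : ∀ (u : CI) (r : Set.Icc (0:ℝ) 1), extCI (source F (0, lam) u) r / extCI u r ^ (p - 1) =
      lam * (F (r, u r) / u r ^ (p - 1)) := by
    intro u r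
    rw [extCI_coe, extCI_coe, source_div]
  have h := solOp_eq_of_weights (N := N) H.hp hN (source_nonneg H.nonneg hz)
    (hu.source_pos H.hp H.pos' hz) (source_nonneg H.nonneg hz) (hv.source_pos H.hp H.pos' hz)
    (a := fun r => extCI (source F (0, lam) u) r / extCI u r ^ (p - 1))
    (b := fun r => extCI (source F (0, lam) v) r / extCI v r ^ (p - 1)) ?_ ?_ ?_ ?_
    (max_lt hc (max_lt hc₁ hc₂)) ?_
  · rwa [← hu.1, ← hv.1] at h
  · intro r hr
    rw [← hu.1, div_mul_cancel₀ _ (Real.rpow_pos_of_pos (hup r hr) _).ne']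
  · intro r hr
    rw [← hv.1, div_mul_cancel₀ _ (Real.rpow_pos_of_pos (hvp r hr) _).ne']
  · intro r hr huv
    have h1 := hup r hr
    have h2 := hvp r hr
    lift r to Set.Icc (0:ℝ) 1 using Set.Ioo_subset_Icc_self hr
    simp only [key]
    rw [← hu.1, ← hv.1] at huv
    simp only [extCI_coe] at h1 h2 huv
    exact mul_le_mul_of_nonneg_left (H.ratio_antitone r h1 h2 huv.le) hlam
  · intro r hr huv
    have h1 := hup r hr
    have h2 := hvp r hr
    lift r to Set.Icc (0:ℝ) 1 using Set.Ioo_subset_Icc_self hr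
    simp only [key]
    rw [← hu.1, ← hv.1] at huv
    simp only [extCI_coe] at h1 h2 huv
    exact mul_le_mul_of_nonneg_left (H.ratio_antitone r h2 h1 huv.le) hlam
  · intro r hr hr0 huv
    have hr' : r ∈ Set.Ioo (0:ℝ) 1 := ⟨hr0, hr.2⟩
    have h1 := hup r hr'
    have h2 := hvp r hr'
    have h3 := h₁ r (((le_max_left _ _).trans (le_max_right _ _)).trans_lt hr.1)
    have h4 := h₂ r (((le_max_right _ _).trans (le_max_right _ _)).trans_lt hr.1)
    have h5 := (le_max_left _ _).trans_lt hr.1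
    lift r to Set.Icc (0:ℝ) 1 using Set.Ioo_subset_Icc_self hr'
    simp only [key]
    rw [← hu.1, ← hv.1] at huv
    simp only [extCI_coe] at h1 h2 h3 h4 huv
    intro heq
    exact huv ((h r h5).injOn ⟨h1, h3⟩ ⟨h2, h4⟩ (mul_left_cancel₀ hlp.ne' heq))

end Nonlin

end nonlin

/-! ### A priori bounds -/

section bounds

variable {p : ℝ} {N : ℕ} {F F₂ : C(Set.Icc (0:ℝ) 1 × ℝ, ℝ)} {w₀ wi w : CI} {z : ℝ × ℝ}
  {u v : CI} {lam κ : ℝ}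

lemma exists_pos_le (hw : ∀ r, 0 < w r) : ∃ m, 0 < m ∧ ∀ r, m ≤ w r := by
  obtain ⟨r₀, -, h⟩ := isCompact_univ.exists_isMinOn ⟨⟨0, le_rfl, zero_le_one⟩, Set.mem_univ _⟩
    w.continuous.continuousOn
  exact ⟨w r₀, hw r₀, fun r => h (Set.mem_univ r)⟩

lemma apply_le_norm (w : CI) (r) : w r ≤ ‖w‖ := (le_abs_self _).trans (w.norm_coe_le_norm r)

theorem PosSol.eigenvalue_eq (hp : 2 < p) (hN : 1 ≤ N) (hw : ∀ r, 0 < w r) (hκ : 0 ≤ κ)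
    (hlam : 0 ≤ lam) (hu : PosSol p N (homFun p w) (0, κ) u)
    (hv : PosSol p N (homFun p w) (0, lam) v) : κ = lam := by
  wlog hle : κ ≤ lam generalizing κ lam u v
  · exact (this hlam hκ hv hu (le_of_not_ge hle)).symm
  obtain ⟨r, -, hr⟩ := exists_Icc_between zero_lt_one
  have hn := homFun_nonneg hp fun r => (hw r).le
  have hp' := homFun_pos hp hw
  have hur : 0 < u r := by
    rw [← extCI_coe]
    exact hu.pos hp hn hp' (zero_le_pair hκ) ⟨hr.1.le, hr.2⟩
  have hvr : 0 < v r := by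
    rw [← extCI_coe]
    exact hv.pos hp hn hp' (zero_le_pair hlam) ⟨hr.1.le, hr.2⟩
  have h := hu.weight_eq hp hN hn hp' hn hp' (zero_le_pair hκ) (zero_le_pair hlam) hv
    (fun r _ hur hvr => ?_) r hr
  · rw [source_homFun_div hp hvr, source_homFun_div hp hur] at h
    exact mul_right_cancel₀ (hw r).ne' h
  · rw [source_homFun_div hp hvr, source_homFun_div hp hur]
    exact mul_le_mul_of_nonneg_right hle (hw r).le

namespace Nonlin

variable (H : Nonlin p F F₂ w₀ wi)
include H

/-- The weight of a positive solution cannot dominate the principal weight strictly. -/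
lemma exists_weight_le (hN : 1 ≤ N) (hκ : 0 ≤ κ) (hv : PosSol p N (homFun p w₀) (0, κ) v)
    (hz : 0 ≤ z) (hu : PosSol p N F z u) :
    ∃ r, 0 < u r ∧ source F z u r / u r ^ (p - 1) ≤ κ * w₀ r := by
  by_contra! hlt
  obtain ⟨r, -, hr⟩ := exists_Icc_between zero_lt_one
  have hvr : 0 < v r := by
    rw [← extCI_coe]
    exact hv.pos H.hp H.homFun₀_nonneg H.homFun₀_pos (zero_le_pair hκ) ⟨hr.1.le, hr.2⟩
  have hur : 0 < u r := by
    rw [← extCI_coe]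
    exact hu.pos H.hp H.nonneg H.pos' hz ⟨hr.1.le, hr.2⟩
  have h := hv.weight_eq H.hp hN H.homFun₀_nonneg H.homFun₀_pos H.nonneg H.pos'
    (zero_le_pair hκ) hz hu (fun r _ hvr hur => ?_) r hr
  · rw [source_homFun_div H.hp hvr] at h
    exact (hlt r hur).ne h
  · rw [source_homFun_div H.hp hvr]
    exact (hlt r hur).le

theorem exists_norm_ge_of_lt (hN : 1 ≤ N) (hκ : 0 ≤ κ)
    (hv : PosSol p N (homFun p w₀) (0, κ) v) (hlt : κ < lam) :
    ∃ d > 0, ∀ z u, 0 ≤ z → lam ≤ z.2 → PosSol p N F z u → d ≤ ‖u‖ := by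
  obtain ⟨m, hm, hmw⟩ := exists_pos_le H.w₀_pos
  have hlam : 0 < lam := hκ.trans_lt hlt
  obtain ⟨d, hd, h⟩ := H.lim_zero (m * (lam - κ) / (2 * lam))
    (div_pos (mul_pos hm (sub_pos.2 hlt)) (by positivity))
  refine ⟨d, hd, fun z u hz hz2 hu => ?_⟩
  by_contra! hlt'
  obtain ⟨r, hur, hr⟩ := H.exists_weight_le hN hκ hv hz hu
  have h1 := (abs_lt.1 (h (u r) ⟨hur, (apply_le_norm u r).trans_lt hlt'⟩ r)).1
  have h2 : 0 ≤ F (r, u r) / u r ^ (p - 1) :=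
    div_nonneg (H.nonneg _) (Real.rpow_nonneg hur.le _)
  rw [source_apply, add_div, mul_div_assoc] at hr
  have h3 : 0 ≤ z.1 / u r ^ (p - 1) := div_nonneg hz.1 (Real.rpow_nonneg hur.le _)
  have h4 := mul_le_mul_of_nonneg_right hz2 h2
  have h5 : lam * (m * (lam - κ) / (2 * lam)) = m * (lam - κ) / 2 := by field_simp
  have h6 := mul_lt_mul_of_pos_left h1 hlam
  have h7 := mul_le_mul_of_nonneg_right (hmw r) (sub_pos.2 hlt).le
  have h8 : 0 < w₀ r * (lam - κ) := mul_pos (H.w₀_pos r) (sub_pos.2 hlt)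
  nlinarith

theorem exists_norm_ge_of_pos (hN : 1 ≤ N) (hκ : 0 ≤ κ)
    (hv : PosSol p N (homFun p w₀) (0, κ) v) {μ : ℝ} (hμ : 0 < μ) :
    ∃ d > 0, ∀ z u, 0 ≤ z → μ ≤ z.1 → PosSol p N F z u → d ≤ ‖u‖ := by
  have hp1 : 0 < p - 1 := by linarith [H.hp]
  have hA : 0 < κ * ‖w₀‖ + 1 := by positivity
  have hB : 0 < μ / (κ * ‖w₀‖ + 1) := div_pos hμ hA
  refine ⟨(μ / (κ * ‖w₀‖ + 1)) ^ (p - 1)⁻¹, Real.rpow_pos_of_pos hB _, fun z u hz hz1 hu => ?_⟩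
  by_contra! hlt
  obtain ⟨r, hur, hr⟩ := H.exists_weight_le hN hκ hv hz hu
  have h1 := Real.rpow_lt_rpow hur.le ((apply_le_norm u r).trans_lt hlt) hp1
  rw [← Real.rpow_mul hB.le, inv_mul_cancel₀ hp1.ne', Real.rpow_one, lt_div_iff₀ hA] at h1
  have h2 := Real.rpow_pos_of_pos hur (p - 1)
  rw [div_le_iff₀ h2, source_apply] at hr
  have h3 : 0 ≤ z.2 * F (r, u r) := mul_nonneg hz.2 (H.nonneg _)
  have h4 := mul_le_mul_of_nonneg_left (apply_le_norm w₀ r) hκ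
  nlinarith [mul_le_mul_of_nonneg_right h4 h2.le]

lemma exists_abs_sub_le {e : ℝ} (he : 0 < e) :
    ∃ C, 0 ≤ C ∧ ∀ r x, 0 ≤ x → |F (r, x) - homFun p wi (r, x)| ≤ e * x ^ (p - 1) + C := by
  obtain ⟨M, hM⟩ := H.lim_infty e he
  have hK : IsCompact ((Set.univ : Set (Set.Icc (0:ℝ) 1)) ×ˢ Set.Icc 0 (max M 1)) :=
    isCompact_univ.prod isCompact_Icc
  obtain ⟨C, hC⟩ := hK.exists_bound_of_continuousOn (F - homFun p wi).continuous.continuousOn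
  refine ⟨max C 0, le_max_right _ _, fun r x hx => ?_⟩
  have hx' := Real.rpow_nonneg hx (p - 1)
  rcases le_or_gt x (max M 1) with h | h
  · have := (hC (r, x) ⟨Set.mem_univ _, hx, h⟩).trans (le_max_left C 0)
    rw [Real.norm_eq_abs] at this
    exact this.trans (le_add_of_nonneg_left (by positivity))
  · have hx0 : 0 < x := (zero_lt_one.trans_le (le_max_right _ _)).trans h
    have h1 := (hM x hx0 ((le_max_left _ _).trans h.le) r).le
    have h2 := Real.rpow_pos_of_pos hx0 (p - 1)
    have h3 : F (r, x) - homFun p wi (r, x) = (F (r, x) / x ^ (p - 1) - wi r) * x ^ (p - 1) := by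
      rw [homFun_apply H.hp, abs_of_pos hx0]
      field_simp
    rw [h3, abs_mul, abs_of_pos h2]
    have := mul_le_mul_of_nonneg_right h1 h2.le
    linarith [le_max_right C 0]

/-- Normalized positive solutions of unbounded norm converge to principal eigenfunctions. -/
theorem exists_homFun_posSol {z : ℕ → ℝ × ℝ} {z₀ : ℝ × ℝ} (hz : Tendsto z atTop (𝓝 z₀))
    (hz0 : ∀ n, 0 ≤ z n) {u : ℕ → CI} (hu : ∀ n, PosSol p N F (z n) (u n))
    (hinf : Tendsto (fun n => ‖u n‖) atTop atTop) :
    ∃ v, PosSol p N (homFun p wi) (0, z₀.2) v := by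
  obtain ⟨Z, hZ0, hZ⟩ := exists_norm_bound_seq hz
  have hp1 : 0 < p - 1 := by linarith [H.hp]
  have hα : ∀ n, 0 < ‖u n‖ := fun n => norm_pos_iff.2 (hu n).ne_zero
  set α : ℕ → ℝ := fun n => ‖u n‖ with hαdef
  set v : ℕ → CI := fun n => (α n)⁻¹ • u n with hv
  set h : ℕ → CI := fun n => ((α n)⁻¹) ^ (p - 1) • source F (z n) (u n) with hh
  have hvh : ∀ n, v n = solOp p N (h n) := by
    intro n
    rw [hh, solOp_smul H.hp (source_nonneg H.nonneg (hz0 n)) (inv_nonneg.2 (hα n).le), ← (hu n).1]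
  have hv1 : ∀ n, ‖v n‖ = 1 := by
    intro n
    rw [hv, norm_smul, norm_inv, norm_norm, inv_mul_cancel₀ (hα n).ne']
  have hv0 : ∀ n, extCI (v n) 0 = 1 := by
    intro n
    rw [hv, extCI_smul, ← (hu n).norm_eq H.hp H.nonneg (hz0 n), inv_mul_cancel₀ (hα n).ne']
  have hαp : Tendsto (fun n => (α n)⁻¹ ^ (p - 1)) atTop (𝓝 0) := by
    have := (tendsto_rpow_neg_atTop hp1).comp hinf
    refine this.congr fun n => ?_
    rw [Function.comp_apply, Real.rpow_neg (hα n).le, Real.inv_rpow (hα n).le]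
  have hdiff : Tendsto (fun n => h n - source (homFun p wi) (0, (z n).2) (v n)) atTop (𝓝 0) := by
    rw [Metric.tendsto_atTop]
    intro ε hε
    obtain ⟨C, hC0, hC⟩ := H.exists_abs_sub_le (e := ε / (4 * (Z + 1))) (by positivity)
    have h1 : Tendsto (fun n => (α n)⁻¹ ^ (p - 1) * (Z * (1 + C))) atTop (𝓝 0) := by
      simpa using hαp.mul_const (Z * (1 + C))
    obtain ⟨n₀, hn₀⟩ := (h1.eventually (gt_mem_nhds (by positivity : 0 < ε / 4))).exists_forall_of_atTop
    refine ⟨n₀, fun n hn => ?_⟩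
    rw [dist_zero_right]
    refine lt_of_le_of_lt ((ContinuousMap.norm_le _ (by positivity : 0 ≤ ε / 2)).2 fun r => ?_)
      (by linarith)
    have hur := (hu n).nonneg H.hp H.nonneg (hz0 n) r
    have ha : 0 ≤ (α n)⁻¹ ^ (p - 1) := Real.rpow_nonneg (inv_nonneg.2 (hα n).le) _
    have h2 : (h n - source (homFun p wi) (0, (z n).2) (v n)) r =
        (α n)⁻¹ ^ (p - 1) * ((z n).1 + (z n).2 * (F (r, u n r) - homFun p wi (r, u n r))) := by
      rw [ContinuousMap.sub_apply, source_apply, homFun_apply H.hp, homFun_apply H.hp]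
      simp only [hh, hv, ContinuousMap.smul_apply, smul_eq_mul, source_apply]
      rw [abs_mul, abs_of_pos (inv_pos.2 (hα n)), Real.mul_rpow (inv_nonneg.2 (hα n).le) (abs_nonneg _)]
      ring
    have h3 : (α n)⁻¹ ^ (p - 1) * u n r ^ (p - 1) ≤ 1 := by
      rw [← Real.mul_rpow (inv_nonneg.2 (hα n).le) hur]
      refine Real.rpow_le_one (mul_nonneg (inv_nonneg.2 (hα n).le) hur) ?_ hp1.le
      rw [inv_mul_le_one₀ (hα n)]
      exact apply_le_norm _ _
    have h4 : |(z n).1 + (z n).2 * (F (r, u n r) - homFun p wi (r, u n r))| ≤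
        Z + Z * (ε / (4 * (Z + 1)) * u n r ^ (p - 1) + C) := by
      refine (abs_add_le _ _).trans (add_le_add ((norm_fst_le (z n)).trans (hZ n)) ?_)
      rw [abs_mul]
      exact mul_le_mul ((norm_snd_le (z n)).trans (hZ n)) (hC r _ hur) (abs_nonneg _) hZ0
    rw [h2, Real.norm_eq_abs, abs_mul, abs_of_nonneg ha]
    have h5 := mul_le_mul_of_nonneg_left h4 ha
    have h6 : Z * (ε / (4 * (Z + 1))) ≤ ε / 4 := by
      rw [mul_div_assoc', div_le_div_iff₀ (by positivity) (by positivity)]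
      nlinarith
    have h7 : Z * (ε / (4 * (Z + 1))) * ((α n)⁻¹ ^ (p - 1) * u n r ^ (p - 1)) ≤
        Z * (ε / (4 * (Z + 1))) := mul_le_of_le_one_right (by positivity) h3
    have h8 := hn₀ n hn
    calc _ ≤ _ := h5
      _ = (α n)⁻¹ ^ (p - 1) * (Z * (1 + C)) +
        Z * (ε / (4 * (Z + 1))) * ((α n)⁻¹ ^ (p - 1) * u n r ^ (p - 1)) := by ring
      _ ≤ _ := by linarith
  have hz' : Tendsto (fun n => ((0:ℝ), (z n).2)) atTop (𝓝 (0, z₀.2)) :=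
    tendsto_const_nhds.prodMk_nhds ((continuous_snd.tendsto _).comp hz)
  obtain ⟨C, hC⟩ := norm_nem_le (homFun p wi) 1
  obtain ⟨D, hD⟩ := (Metric.isBounded_range_of_tendsto _ hdiff).exists_norm_le
  have hb : ∀ n, ‖h n‖ ≤ D + Z * C := by
    intro n
    have h1 : h n = (h n - source (homFun p wi) (0, (z n).2) (v n)) +
      source (homFun p wi) (0, (z n).2) (v n) := by abel
    rw [h1]
    refine (norm_add_le _ _).trans (add_le_add (hD _ ⟨n, rfl⟩) ?_)
    rw [source, zero_smul, zero_add, norm_smul]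
    exact mul_le_mul ((norm_snd_le (z n)).trans (hZ n)) (hC _ (hv1 n).le) (norm_nonneg _) hZ0
  obtain ⟨v₀, φ, hφ, ht⟩ := exists_subseq_solOp (N := N) H.hp hb
  have ht' : Tendsto (fun n => v (φ n)) atTop (𝓝 v₀) := ht.congr fun n => (hvh (φ n)).symm
  have hs := ((continuous_source (F := homFun p wi)).tendsto ((0, z₀.2), v₀)).comp
    ((hz'.comp hφ.tendsto_atTop).prodMk_nhds ht')
  have hh' : Tendsto (fun n => h (φ n)) atTop (𝓝 (source (homFun p wi) (0, z₀.2) v₀)) := by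
    have := (hdiff.comp hφ.tendsto_atTop).add hs
    rw [zero_add] at this
    refine this.congr fun n => ?_
    simp
  refine ⟨v₀, ?_, ?_⟩
  · exact tendsto_nhds_unique ht ((continuous_solOp.tendsto _).comp hh')
  · have h3 : Tendsto (fun n => extCI (v (φ n)) 0) atTop (𝓝 (extCI v₀ 0)) :=
      ((continuous_eval_const (F := CI) (Set.projIcc (0:ℝ) 1 zero_le_one 0)).tendsto
        v₀).comp ht'
    simp only [hv0] at h3
    rw [← tendsto_nhds_unique tendsto_const_nhds h3]
    exact one_pos

/-- Positive solutions are bounded as long as the problem at infinity is nonresonant. -/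
theorem exists_norm_le {K : Set (ℝ × ℝ)} (hK : IsCompact K) (hK0 : ∀ z ∈ K, 0 ≤ z)
    (hn : ∀ z ∈ K, ∀ v, ¬ PosSol p N (homFun p wi) (0, z.2) v) :
    ∃ R, ∀ z ∈ K, ∀ u, PosSol p N F z u → ‖u‖ ≤ R := by
  by_contra! hR
  choose z hz u hu hlt using fun n : ℕ => hR n
  obtain ⟨z₀, hz₀, φ, hφ, ht⟩ := hK.tendsto_subseq hz
  have hinf : Tendsto (fun n => ‖u n‖) atTop atTop :=
    tendsto_atTop_mono (fun n => (hlt n).le) tendsto_natCast_atTop_atTop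
  obtain ⟨v, hv⟩ := H.exists_homFun_posSol ht (fun n => hK0 _ (hz _)) (fun n => hu (φ n))
    (hinf.comp hφ.tendsto_atTop)
  exact hn z₀ hz₀ v hv

end Nonlin

end bounds

/-! ### The solution curve -/

section curve

lemma continuousAt_of_hasStrictDerivAt {E : Type*} [NormedAddCommGroup E] [NormedSpace ℝ E]
    {f f' : ℝ → E} {x₀ : ℝ} (h : HasStrictDerivAt f (f' x₀) x₀)
    (h' : ∀ᶠ y in 𝓝 x₀, HasDerivAt f (f' y) y) : ContinuousAt f' x₀ := by
  rw [Metric.continuousAt_iff']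
  intro ε hε
  have h1 := (hasStrictDerivAt_iff_hasStrictFDerivAt.1 h).isLittleO.def (half_pos hε)
  have hd : Tendsto (fun y : ℝ => (y, y)) (𝓝 x₀) (𝓝 (x₀, x₀)) := (by fun_prop : Continuous
    fun y : ℝ => (y, y)).tendsto x₀
  filter_upwards [h', hd.eventually h1.eventually_nhds] with y hy hy'
  rw [dist_eq_norm]
  have h2 : HasDerivAt (fun x => f x - (x - y) • f' x₀) (f' y - f' x₀) y := by
    have := hy.sub (((hasDerivAt_id y).sub_const y).smul_const (f' x₀))
    rwa [one_smul] at this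
  refine (h2.le_of_lip' (half_pos hε).le ?_).trans_lt (half_lt_self hε)
  have hd' : Tendsto (fun x : ℝ => (x, y)) (𝓝 y) (𝓝 (y, y)) := (by fun_prop : Continuous
    fun x : ℝ => (x, y)).tendsto y
  filter_upwards [hd'.eventually hy'] with x hx
  refine le_of_eq_of_le (congrArg norm ?_) hx
  rw [ContinuousLinearMap.toSpanSingleton_apply, sub_self, zero_smul]
  abel

variable {p : ℝ} {N : ℕ} {F F₂ : C(Set.Icc (0:ℝ) 1 × ℝ, ℝ)} {w₀ wi w : CI} {z z₀ : ℝ × ℝ}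
  {u v : CI} {lam κ : ℝ}

namespace Nonlin

variable (H : Nonlin p F F₂ w₀ wi)
include H

/-- Positive solutions are nondegenerate. -/
theorem exists_branch (hN : 1 ≤ N) (hz : 0 ≤ z₀) (hu : PosSol p N F z₀ u) :
    ∃ ψ : ℝ × ℝ → CI, ∃ ψ' : ℝ × ℝ →L[ℝ] CI, HasStrictFDerivAt ψ ψ' z₀ ∧ ψ z₀ = u ∧
      ∀ᶠ z in 𝓝 z₀, PosSol p N F z (ψ z) := by
  have hp1 : 0 < p - 1 := by linarith [H.hp]
  obtain ⟨c, hc, ε, hε, h⟩ := H.deriv_lt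
  obtain ⟨c', hc', h'⟩ := hu.exists_lt_near_one H.hp hε
  have hz1 : 0 ≤ z₀.1 := hz.1
  have hz2 : 0 ≤ z₀.2 := hz.2
  have hbr := exists_local_branch (N := N) H.hp hN F F₂ H.hasDerivAt z₀ hu.1
    (source_nonneg H.nonneg hz) (hu.source_pos H.hp H.pos' hz) (fun r => ?_) (max_lt hc hc')
    (fun r hr hr1 => ?_)
  · obtain ⟨ψ, ψ', hψ, hψu, hψz⟩ := hbr
    refine ⟨ψ, ψ', hψ, hψu, ?_⟩
    have h1 : Tendsto (fun z => extCI (ψ z) 0) (𝓝 z₀) (𝓝 (extCI (ψ z₀) 0)) :=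
      ((continuous_eval_const (F := CI) (Set.projIcc (0:ℝ) 1 zero_le_one 0)).tendsto
        (ψ z₀)).comp hψ.continuousAt
    rw [hψu] at h1
    filter_upwards [hψz, h1.eventually (lt_mem_nhds hu.2)] with z hz1 hz2 using ⟨hz1, hz2⟩
  · have h1 := H.deriv_le r (u r) (hu.nonneg H.hp H.nonneg hz r)
    have h2 : source F z₀ u r = _ := source_apply r
    rw [source] at h2
    rw [h2]
    nlinarith [mul_le_mul_of_nonneg_left h1 hz2, mul_nonneg hp1.le hz1]
  · have h2 : source F z₀ u r = _ := source_apply r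
    rw [source] at h2
    rw [h2]
    have hur : 0 < u r := by
      rw [← extCI_coe]
      exact hu.pos H.hp H.nonneg H.pos' hz ⟨r.2.1, hr1⟩
    have hur' : u r < ε := by
      rw [← extCI_coe]
      exact h' r ((le_max_right _ _).trans_lt hr)
    have h1 := h r ((le_max_left _ _).trans_lt hr) (u r) ⟨hur, hur'⟩
    rcases hz2.eq_or_lt with h0 | h0
    · rw [← h0]
      have : 0 < z₀.1 := by
        refine hz1.lt_of_ne fun h00 => hu.ne_zero ?_
        rw [hu.1, source, ← h0, ← h00, zero_smul, zero_smul, add_zero, solOp_zero H.hp]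
      nlinarith [mul_pos hp1 this]
    · nlinarith [mul_lt_mul_of_pos_left h1 h0, mul_nonneg hp1.le hz1]

/-- Existence of positive solutions, by continuation from the torsion problem `z = (1, 0)`. -/
theorem exists_posSol (hN : 1 ≤ N) (hκ : 0 ≤ κ) (hv : PosSol p N (homFun p w₀) (0, κ) v)
    (hlt : κ < lam) (hn : ∀ s ∈ Set.Icc 0 lam, ∀ v, ¬ PosSol p N (homFun p wi) (0, s) v) :
    ∃ u, PosSol p N F (0, lam) u := by
  have hlam : 0 < lam := hκ.trans_lt hlt
  set γ : ℝ → ℝ × ℝ := fun τ => (1 - τ, τ * lam) with hγ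
  have hγc : Continuous γ := by fun_prop
  have hγ0 : ∀ τ ∈ Set.Icc (0:ℝ) 1, 0 ≤ γ τ := fun τ hτ =>
    ⟨sub_nonneg.2 hτ.2, mul_nonneg hτ.1 hlam.le⟩
  obtain ⟨R, hR⟩ := H.exists_norm_le (N := N) (isCompact_Icc.image hγc)
    (by rintro _ ⟨τ, hτ, rfl⟩; exact hγ0 τ hτ)
    (by
      rintro _ ⟨τ, hτ, rfl⟩
      exact hn _ ⟨mul_nonneg hτ.1 hlam.le, mul_le_of_le_one_left hlam.le hτ.2⟩)
  have hmid : κ < (κ + lam) / 2 := by linarith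
  have hμ : 0 < 1 - (κ + lam) / 2 / lam := by
    rw [sub_pos, div_lt_one hlam]
    linarith
  obtain ⟨d₁, hd₁, h₁⟩ := H.exists_norm_ge_of_lt hN hκ hv hmid
  obtain ⟨d₂, hd₂, h₂⟩ := H.exists_norm_ge_of_pos hN hκ hv hμ
  have hd : ∀ τ ∈ Set.Icc (0:ℝ) 1, ∀ u, PosSol p N F (γ τ) u → min d₁ d₂ ≤ ‖u‖ := by
    intro τ hτ u hu
    rcases le_total ((κ + lam) / 2) (τ * lam) with h | h
    · exact (min_le_left _ _).trans (h₁ _ u (hγ0 τ hτ) h hu)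
    · refine (min_le_right _ _).trans (h₂ _ u (hγ0 τ hτ) ?_ hu)
      exact sub_le_sub_left ((le_div_iff₀ hlam).2 h) _
  have key : Set.Icc (0:ℝ) 1 ⊆ {τ | ∃ u, PosSol p N F (γ τ) u} := by
    refine IsClosed.Icc_subset_of_forall_mem_nhdsWithin ?_ ?_ ?_
    · refine IsSeqClosed.isClosed fun τ τ₀ hτ ht => ?_
      have hτ₀ : τ₀ ∈ Set.Icc (0:ℝ) 1 := isClosed_Icc.mem_of_tendsto ht (Eventually.of_forall
        fun n => (hτ n).2)
      choose u hu using fun n => (hτ n).1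
      exact ⟨exists_posSol_of_tendsto H.hp H.nonneg ((hγc.tendsto τ₀).comp ht)
        (fun n => hγ0 _ (hτ n).2) hu (lt_min hd₁ hd₂) (fun n => hd _ (hτ n).2 _ (hu n))
        (fun n => hR _ ⟨_, (hτ n).2, rfl⟩ _ (hu n)), hτ₀⟩
    · have h0 : ∀ u, source F (γ 0) u = 1 := fun u => by simp [source, hγ]
      refine ⟨solOp p N 1, ?_, ?_⟩
      · rw [h0]
      · refine solOp_pos H.hp (fun r => zero_le_one) ?_ ⟨le_rfl, zero_lt_one⟩
        rw [extCI_of_mem _ ⟨le_rfl, zero_le_one⟩]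
        exact zero_lt_one
    · rintro τ ⟨⟨u, hu⟩, hτ⟩
      obtain ⟨ψ, -, -, -, hψ⟩ := H.exists_branch hN (hγ0 τ ⟨hτ.1, hτ.2.le⟩) hu
      refine mem_nhdsWithin_of_mem_nhds ?_
      filter_upwards [(hγc.tendsto τ).eventually hψ] with s hs using ⟨_, hs⟩
  obtain ⟨u, hu⟩ := key (Set.right_mem_Icc.2 zero_le_one)
  rw [hγ] at hu
  simp only [sub_self, one_mul] at hu
  exact ⟨u, hu⟩

/-- A selection of the positive solutions is strictly differentiable. -/
theorem hasStrictDerivAt_posSol (hN : 1 ≤ N) {U : ℝ → CI}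
    (hU : ∀ s, (∃ u, PosSol p N F (0, s) u) → PosSol p N F (0, s) (U s)) (hlam : 0 < lam)
    (hu : PosSol p N F (0, lam) u) : ∃ U', HasStrictDerivAt U U' lam := by
  obtain ⟨ψ, ψ', hψ, -, hψz⟩ := H.exists_branch hN (zero_le_pair hlam.le) hu
  have h1 : HasStrictDerivAt (fun s : ℝ => ((0:ℝ), s)) (0, 1) lam :=
    (hasStrictDerivAt_const lam (0:ℝ)).prodMk (hasStrictDerivAt_id lam)
  have h2 := hψ.comp_hasStrictDerivAt lam h1
  refine ⟨_, h2.congr_of_eventuallyEq ?_⟩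
  have h3 : Tendsto (fun s : ℝ => ((0:ℝ), s)) (𝓝 lam) (𝓝 (0, lam)) := h1.hasDerivAt.continuousAt
  filter_upwards [h3.eventually hψz, lt_mem_nhds hlam] with s hs hs0
  exact H.posSol_unique hN hs0.le hs (hU s ⟨_, hs⟩)

/-- The solution curve emanates from the trivial solution at the eigenvalue at zero. -/
theorem tendsto_norm_zero (hN : 1 ≤ N) (hκ : 0 ≤ κ) (hv : PosSol p N (homFun p w₀) (0, κ) v)
    (hlt : κ < lam) (hn : ∀ s ∈ Set.Icc 0 lam, ∀ v, ¬ PosSol p N (homFun p wi) (0, s) v)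
    {U : ℝ → CI} (hU : ∀ s ∈ Set.Ioo κ lam, PosSol p N F (0, s) (U s)) :
    Tendsto (fun s => ‖U s‖) (𝓝[>] κ) (𝓝 0) := by
  obtain ⟨R, hR⟩ := H.exists_norm_le (N := N) (K := (fun s => ((0:ℝ), s)) '' Set.Icc 0 lam)
    (isCompact_Icc.image (by fun_prop))
    (by rintro _ ⟨s, hs, rfl⟩; exact zero_le_pair hs.1) (by rintro _ ⟨s, hs, rfl⟩; exact hn s hs)
  rw [Metric.tendsto_nhds]
  by_contra! ⟨ε, hε, hf⟩
  obtain ⟨s, hs, h⟩ := exists_seq_forall_of_frequently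
    (Filter.Frequently.and_eventually hf (Ioo_mem_nhdsGT hlt))
  have hs' : Tendsto (fun n => ((0:ℝ), s n)) atTop (𝓝 (0, κ)) :=
    tendsto_const_nhds.prodMk_nhds (tendsto_nhdsWithin_iff.1 hs).1
  have h0 : ∀ n, 0 ≤ s n := fun n => hκ.trans (h n).2.1.le
  have hε' : ∀ n, ε ≤ ‖U (s n)‖ := by
    intro n
    have := (h n).1
    rwa [dist_zero_right, norm_norm] at this
  obtain ⟨u, hu⟩ := exists_posSol_of_tendsto H.hp H.nonneg hs' (fun n => zero_le_pair (h0 n))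
    (fun n => hU _ (h n).2) hε hε'
    (fun n => hR _ ⟨s n, ⟨h0 n, (h n).2.2.le⟩, rfl⟩ _ (hU _ (h n).2))
  exact lt_irrefl _ (H.lt_of_posSol hN hκ hv hκ hu)

/-- The solution curve blows up at the eigenvalue at infinity. -/
theorem tendsto_norm_atTop_nhdsLT (hN : 1 ≤ N) (hwi : ∀ r, 0 < wi r) (hκ : 0 ≤ κ)
    (hv : PosSol p N (homFun p w₀) (0, κ) v) (hlt : κ < lam)
    (hu : PosSol p N (homFun p wi) (0, lam) u)
    {U : ℝ → CI} (hU : ∀ s ∈ Set.Ioo κ lam, PosSol p N F (0, s) (U s)) :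
    Tendsto (fun s => ‖U s‖) (𝓝[<] lam) atTop := by
  have hmid : κ < (κ + lam) / 2 := by linarith
  have hmid' : (κ + lam) / 2 < lam := by linarith
  obtain ⟨d, hd, hd'⟩ := H.exists_norm_ge_of_lt hN hκ hv hmid
  rw [tendsto_atTop]
  by_contra! ⟨R, hf⟩
  obtain ⟨s, hs, h⟩ := exists_seq_forall_of_frequently
    (Filter.Frequently.and_eventually hf (Ioo_mem_nhdsLT hmid'))
  have hs' : Tendsto (fun n => ((0:ℝ), s n)) atTop (𝓝 (0, lam)) :=
    tendsto_const_nhds.prodMk_nhds (tendsto_nhdsWithin_iff.1 hs).1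
  have h1 : ∀ n, s n ∈ Set.Ioo κ lam := fun n => ⟨hmid.trans (h n).2.1, (h n).2.2⟩
  have h0 : ∀ n, 0 ≤ s n := fun n => hκ.trans (h1 n).1.le
  obtain ⟨u₀, hu₀⟩ := exists_posSol_of_tendsto H.hp H.nonneg hs' (fun n => zero_le_pair (h0 n))
    (fun n => hU _ (h1 n)) hd
    (fun n => hd' _ _ (zero_le_pair (h0 n)) (h n).2.1.le (hU _ (h1 n)))
    (fun n => (h n).1.le)
  have hlam : 0 ≤ lam := hκ.trans hlt.le
  exact lt_irrefl _ (H.posSol_lt hN hwi hlam hu hlam hu₀)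

theorem tendsto_norm_atTop_atTop (hN : 1 ≤ N) (hκ : 0 ≤ κ)
    (hv : PosSol p N (homFun p w₀) (0, κ) v)
    {U : ℝ → CI} (hU : ∀ s ∈ Set.Ioi κ, PosSol p N F (0, s) (U s)) :
    Tendsto (fun s => ‖U s‖) atTop atTop := by
  rw [tendsto_atTop]
  intro R
  set S := max R 1 with hS
  have hS0 : 0 < S := zero_lt_one.trans_le (le_max_right _ _)
  let g : CI := F.comp ⟨fun r => (r, S), by fun_prop⟩
  obtain ⟨m, hm, hmg⟩ := exists_pos_le (w := g) fun r => H.pos' r S hS0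
  have hSp := Real.rpow_pos_of_pos hS0 (p - 1)
  have hm' : 0 < m / S ^ (p - 1) := div_pos hm hSp
  filter_upwards [eventually_gt_atTop κ, eventually_gt_atTop (κ * ‖w₀‖ / (m / S ^ (p - 1)))]
    with s hs hs'
  by_contra! hlt
  have hs0 : 0 ≤ s := hκ.trans hs.le
  obtain ⟨r, hur, hr⟩ := H.exists_weight_le hN hκ hv (zero_le_pair hs0) (hU s hs)
  rw [div_lt_iff₀ hm'] at hs'
  rw [source_div] at hr
  have h1 : U s r ≤ S := (apply_le_norm _ r).trans (hlt.le.trans (le_max_left _ _))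
  have h2 := H.ratio_antitone r hur hS0 h1
  simp only at h2
  have h3 : m / S ^ (p - 1) ≤ F (r, S) / S ^ (p - 1) := div_le_div_of_nonneg_right (hmg r) hSp.le
  have h4 := mul_le_mul_of_nonneg_left (h3.trans h2) hs0
  have h5 := mul_le_mul_of_nonneg_left (apply_le_norm w₀ r) hκ
  linarith

end Nonlin

end curve

/-! ### Solutions of the boundary value problem -/

section translation

variable {p : ℝ} {N : ℕ} {F F₂ : C(Set.Icc (0:ℝ) 1 × ℝ, ℝ)} {w₀ wi w : CI} {u v : ℝ → ℝ}
  {f f₂ : ℝ → ℝ → ℝ} {f0 finf : ℝ → ℝ} {lam κ : ℝ}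

theorem IsRadialSol.exists_posSol (hp : 2 < p) (hN : 1 ≤ N) (hF : ∀ q, 0 ≤ F q) (hlam : 0 ≤ lam)
    {g : ℝ → ℝ} (hu : IsRadialSol p N g u) (hg : ∀ r : Set.Icc (0:ℝ) 1, (r : ℝ) ∈ Set.Ioo (0:ℝ) 1 →
      g r = lam * F (r, u r)) (hnt : Nontriv01 u) :
    ∃ U, PosSol p N F (0, lam) U ∧ Set.EqOn u (extCI U) (Set.Icc 0 1) := by
  let U : CI := ⟨fun r => u r, hu.1.continuousOn.domRestrict⟩
  have hU : Set.EqOn u (extCI U) (Set.Icc 0 1) := fun r hr => (extCI_of_mem U hr).symm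
  have hs := source_nonneg (u := U) hF (zero_le_pair hlam)
  have h1 : Set.EqOn u (extCI (solOp p N (source F (0, lam) U))) (Set.Icc 0 1) := by
    refine hu.eqOn_solOp hp hN hs fun r hr => ?_
    have hr' := Set.Ioo_subset_Icc_self hr
    rw [extCI_of_mem _ hr', source_apply, zero_add]
    exact hg ⟨r, hr'⟩ hr
  have h2 : U = solOp p N (source F (0, lam) U) := by
    ext r
    exact (h1 r.2).trans (extCI_coe _ r)
  refine ⟨U, ⟨h2, ?_⟩, hU⟩
  have h3 := norm_solOp (N := N) hp hs
  rw [← h2] at h3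
  rw [← h3, norm_pos_iff]
  intro h0
  obtain ⟨r, hr, hne⟩ := hnt
  refine hne ((hU hr).trans ?_)
  rw [h0, extCI_of_mem _ hr]
  rfl

theorem IsPrincipalEigenpair.exists_posSol (hp : 2 < p) (hN : 1 ≤ N) (hw : ∀ r, 0 ≤ w r)
    {w' : ℝ → ℝ} (hww' : ∀ r : Set.Icc (0:ℝ) 1, w r = w' r)
    (hv : IsPrincipalEigenpair p N w' lam v) : ∃ V, PosSol p N (homFun p w) (0, lam) V := by
  obtain ⟨hlam, h1, h2, hpos, h3, h4, h5⟩ := hv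
  have hr : IsRadialSol p N (fun r => lam * (w' r * phi p (v r))) v :=
    ⟨h1, h2, fun r hr => (h3 r hr).congr_deriv (by ring), h4, h5⟩
  have hg : ∀ r : Set.Icc (0:ℝ) 1, (r : ℝ) ∈ Set.Ioo (0:ℝ) 1 →
      lam * (w' r * phi p (v r)) = lam * homFun p w (r, v r) := by
    intro r hr
    have h := hpos r ⟨hr.1.le, hr.2⟩
    rw [homFun_apply hp, phi_of_nonneg hp h.le, abs_of_pos h, hww']
  obtain ⟨V, hV, -⟩ := hr.exists_posSol hp hN (homFun_nonneg hp hw) hlam.le hg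
    ⟨0, ⟨le_rfl, zero_le_one⟩, (hpos 0 ⟨le_rfl, zero_lt_one⟩).ne'⟩
  exact ⟨V, hV⟩

lemma not_posSol_homFun_of_eq_zero (hp : 2 < p) (hw : ∀ r, w r = 0) (V : CI) :
    ¬ PosSol p N (homFun p w) (0, lam) V := by
  intro h
  refine h.ne_zero ?_
  have hs : source (homFun p w) (0, lam) V = 0 := by
    ext r
    rw [source_apply, homFun_apply hp, hw, zero_mul, mul_zero, add_zero, ContinuousMap.zero_apply]
  rw [h.1, hs, solOp_zero hp]

lemma PosSol.isSolutionP (hp : 2 < p) (hN : 1 ≤ N) (hF : ∀ q, 0 ≤ F q)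
    (hf : ∀ (r : Set.Icc (0:ℝ) 1) x, F (r, x) = f r x) (hlam : 0 ≤ lam) {U : CI}
    (hU : PosSol p N F (0, lam) U) : IsSolutionP p N f lam (extCI U) := by
  have h := isRadialSol_solOp (N := N) hp hN (source_nonneg (u := U) hF (zero_le_pair hlam))
  rw [← hU.1] at h
  obtain ⟨h1, h2, h3, h4, h5⟩ := h
  refine ⟨h1, h2, fun r hr => (h3 r hr).congr_deriv ?_, h4, h5⟩
  have hr' := Set.Ioo_subset_Icc_self hr
  rw [extCI_of_mem _ hr', extCI_of_mem _ hr', source_apply, hf]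
  ring

lemma HypH.exists_nonlin (H : HypH p N f f₂ f0 finf) :
    ∃ (F F₂ : C(Set.Icc (0:ℝ) 1 × ℝ, ℝ)) (w₀ wi : CI), Nonlin p F F₂ w₀ wi ∧
      (∀ (r : Set.Icc (0:ℝ) 1) x, F (r, x) = f r x) ∧ (∀ r : Set.Icc (0:ℝ) 1, w₀ r = f0 r) ∧
      ∀ r : Set.Icc (0:ℝ) 1, wi r = finf r := by
  have hc : Continuous fun q : Set.Icc (0:ℝ) 1 × ℝ => ((q.1 : ℝ), q.2) := by fun_prop
  refine ⟨⟨_, H.hf_cont.comp_continuous hc fun q => ⟨q.1.2, Set.mem_univ _⟩⟩,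
    ⟨_, H.hf₂_cont.comp_continuous hc fun q => ⟨q.1.2, Set.mem_univ _⟩⟩,
    ⟨_, H.hf0_cont.domRestrict⟩, ⟨_, H.hfinf_cont.domRestrict⟩, ⟨H.hp, fun r x => H.hf_deriv r r.2 x,
      fun r x hx => H.hH2 r r.2 x hx, fun r => H.hf_zero r r.2, fun r x hx => H.hH3 r r.2 x hx,
      ?_, ?_, ?_⟩, fun _ _ => rfl, fun _ => rfl, fun _ => rfl⟩
  · obtain ⟨δ, hδ, ε, hε, h⟩ := H.hH3s
    exact ⟨1 - δ, by linarith, ε, hε, fun r hr x hx => h r ⟨hr, r.2.2⟩ x hx⟩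
  · intro e he
    obtain ⟨d, hd, h⟩ := H.hH4a e he
    refine ⟨d, hd, fun x hx r => ?_⟩
    have := h x hx r r.2
    rwa [phi_of_nonneg H.hp hx.1.le] at this
  · intro e he
    obtain ⟨M, h⟩ := H.hH5 e he
    refine ⟨M, fun x hx hMx r => ?_⟩
    have := h x hMx r r.2
    rwa [phi_of_nonneg H.hp hx.le] at this

/-- Assembling the solution curve from existence on an open set `Λ` and the asymptotics. -/
theorem Nonlin.solCurve (H : Nonlin p F F₂ w₀ wi) (hN : 1 ≤ N)
    (hf : ∀ (r : Set.Icc (0:ℝ) 1) x, F (r, x) = f r x) {Λ : Set ℝ} (hΛ : IsOpen Λ)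
    {linf : Filter ℝ} (hpos : ∀ s ∈ Λ, 0 < s) (hex : ∀ s ∈ Λ, ∃ U, PosSol p N F (0, s) U)
    (hmem : ∀ s, 0 < s → ∀ U, PosSol p N F (0, s) U → s ∈ Λ)
    (hzero : ∀ U : ℝ → CI, (∀ s ∈ Λ, PosSol p N F (0, s) (U s)) →
      Tendsto (fun s => ‖U s‖) (𝓝[>] κ) (𝓝 0))
    (hinf : ∀ U : ℝ → CI, (∀ s ∈ Λ, PosSol p N F (0, s) (U s)) →
      Tendsto (fun s => ‖U s‖) linf atTop) : SolCurve p N f κ Λ linf := by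
  have hsel : ∀ s, ∃ U, (∃ u, PosSol p N F (0, s) u) → PosSol p N F (0, s) U := fun s => by
    by_cases h : ∃ u, PosSol p N F (0, s) u
    · exact h.imp fun U hU _ => hU
    · exact ⟨0, fun h' => absurd h' h⟩
  choose U hU using hsel
  have hUΛ : ∀ s ∈ Λ, PosSol p N F (0, s) (U s) := fun s hs => hU s (hex s hs)
  have hstrict : ∀ s ∈ Λ, HasStrictDerivAt U (deriv U s) s := by
    intro s hs
    obtain ⟨U', hU'⟩ := H.hasStrictDerivAt_posSol hN hU (hpos s hs) (hUΛ s hs)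
    rwa [hU'.hasDerivAt.deriv]
  refine ⟨U, deriv U, fun s hs => (hstrict s hs).hasDerivAt, fun s hs => ?_, fun s hs => ?_,
    fun s v hs hv hnt => ?_, hzero U hUΛ, hinf U hUΛ⟩
  · refine (continuousAt_of_hasStrictDerivAt (hstrict s hs) ?_).continuousWithinAt
    filter_upwards [hΛ.mem_nhds hs] with t ht using (hstrict t ht).hasDerivAt
  · have hz := zero_le_pair (hpos s hs).le
    exact ⟨(hUΛ s hs).isSolutionP H.hp hN H.nonneg hf (hpos s hs).le,
      ⟨0, ⟨le_rfl, zero_le_one⟩, (hUΛ s hs).2.ne'⟩,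
      fun r hr => (hUΛ s hs).pos H.hp H.nonneg H.pos' hz hr⟩
  · obtain ⟨h1, h2, h3, h4, h5⟩ := hv
    have hr : IsRadialSol p N (fun r => s * f r (v r)) v :=
      ⟨h1, h2, fun r hr => (h3 r hr).congr_deriv (by ring), h4, h5⟩
    obtain ⟨V, hV, hvV⟩ := hr.exists_posSol H.hp hN H.nonneg hs.le
      (fun r _ => by rw [hf]) hnt
    have hsΛ := hmem s hs V hV
    refine ⟨hsΛ, ?_⟩
    rwa [← H.posSol_unique hN hs.le hV (hUΛ s hsΛ)]

end translation

/-- global bifurcation under (H): all nontrivial solutions of (P) form a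
smooth curve of positive solutions parametrized by `λ ∈ (λ₀, λ∞)`, with
`|u(λ)|₀ → 0` as `λ → λ₀⁺` and `|u(λ)|₀ → ∞` as `λ → λ∞⁻` (as `λ → ∞` when
`f∞ ≡ 0` and `N = 1`). -/
theorem stmt_17 (p : ℝ) (N : ℕ) (f f₂ : ℝ → ℝ → ℝ) (f0 finf : ℝ → ℝ)
    (H : HypH p N f f₂ f0 finf)
    (lam0 : ℝ) (hlam0 : ∃ v, IsPrincipalEigenpair p N f0 lam0 v) :
    -- case (H6)(a): f∞ > 0 with principal eigenvalue λ∞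
    (∀ lamInf : ℝ, (∃ v, IsPrincipalEigenpair p N finf lamInf v) →
      SolCurve p N f lam0 (Set.Ioo lam0 lamInf)
        (nhdsWithin lamInf (Set.Iio lamInf))) ∧
    -- case (H6)(b): N = 1 and f∞ ≡ 0, i.e. λ∞ = ∞
    ((N = 1 ∧ ∀ r ∈ Set.Icc (0:ℝ) 1, finf r = 0) →
      SolCurve p N f lam0 (Set.Ioi lam0) Filter.atTop) := by
  obtain ⟨F, F₂, w₀, wi, hF, hf, hw₀, hwi⟩ := H.exists_nonlin
  obtain ⟨v₀, hv₀⟩ := hlam0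
  have hκ := hv₀.1.le
  obtain ⟨v, hv⟩ := hv₀.exists_posSol H.hp H.hN (fun r => (hF.w₀_pos r).le) hw₀
  refine ⟨fun lamInf ⟨y, hy⟩ => ?_, fun ⟨_, h0⟩ => ?_⟩
  · have hwi_pos : ∀ r, 0 < wi r := by
      rcases H.hH6 with h | ⟨-, h⟩
      · exact fun r => (hwi r).symm ▸ h r r.2
      · have hz : ∀ r, wi r = 0 := fun r => (hwi r).trans (h r r.2)
        obtain ⟨V, hV⟩ := hy.exists_posSol H.hp H.hN (fun r => (hz r).ge) hwi
        exact absurd hV (not_posSol_homFun_of_eq_zero H.hp hz V)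
    obtain ⟨V, hV⟩ := hy.exists_posSol H.hp H.hN (fun r => (hwi_pos r).le) hwi
    have hlt := hF.eigenvalue_lt H.hN hwi_pos hy.1.le hV hκ hv
    have hn : ∀ t < lamInf, ∀ s ∈ Set.Icc 0 t, ∀ y, ¬ PosSol p N (homFun p wi) (0, s) y :=
      fun t ht s hs y hsy =>
        (hs.2.trans_lt ht).ne (hsy.eigenvalue_eq H.hp H.hN hwi_pos hs.1 hy.1.le hV)
    obtain ⟨m, hm, hm'⟩ := exists_between hlt
    exact hF.solCurve H.hN hf isOpen_Ioo (fun s hs => hv₀.1.trans hs.1)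
      (fun s hs => hF.exists_posSol H.hN hκ hv hs.1 (hn s hs.2))
      (fun s hs U hU => ⟨hF.lt_of_posSol H.hN hκ hv hs.le hU,
        hF.posSol_lt H.hN hwi_pos hy.1.le hV hs.le hU⟩)
      (fun U hU => hF.tendsto_norm_zero H.hN hκ hv hm (hn m hm')
        fun s hs => hU s ⟨hs.1, hs.2.trans hm'⟩)
      (fun U hU => hF.tendsto_norm_atTop_nhdsLT H.hN hwi_pos hκ hv hlt hV hU)
  · have hz : ∀ r, wi r = 0 := fun r => (hwi r).trans (h0 r r.2)
    have hn : ∀ t, ∀ s ∈ Set.Icc 0 t, ∀ y, ¬ PosSol p N (homFun p wi) (0, s) y :=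
      fun _ _ _ y => not_posSol_homFun_of_eq_zero H.hp hz y
    exact hF.solCurve H.hN hf isOpen_Ioi (fun s hs => hv₀.1.trans hs)
      (fun s hs => hF.exists_posSol H.hN hκ hv hs (hn s))
      (fun s hs U hU => hF.lt_of_posSol H.hN hκ hv hs.le hU)
      (fun U hU => hF.tendsto_norm_zero H.hN hκ hv (lt_add_one lam0) (hn _)
        fun s hs => hU s hs.1)
      (fun U hU => hF.tendsto_norm_atTop_atTop H.hN hκ hv hU)
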